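/- Let h be a 3-step nilpotent real Lie algebra with dim Z(h) = 1 and let ⟨·,·⟩ be an Einstein Lorentzian inner product on h such that Z(h) is nondegenerate. Then ⟨·,·⟩ is Ricci-flat and dim h ∈ {6, 7}. -/

import Mathlib

open Module LinearMap

noncomputable section

/-- A bilinear form is Lorentzian if it admits an orthonormal basis with exactly one
timelike vector, i.e. it has signature `(1, dim − 1)`. -/
def IsLorentzianForm {H : Type*} [AddCommGroup H] [Module ℝ H]
    (B : H →ₗ[ℝ] H →ₗ[ℝ] ℝ) : Prop :=
  ∃ (n : ℕ) (b : Basis (Fin (n + 1)) ℝ H),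
    (∀ i j, i ≠ j → B (b i) (b j) = 0) ∧
    B (b 0) (b 0) = -1 ∧ ∀ i, i ≠ 0 → B (b i) (b i) = 1

section Bilinear

variable {V : Type*} [AddCommGroup V] [Module ℝ V] {B : V →ₗ[ℝ] V →ₗ[ℝ] ℝ}
  {ι : Type*} [Fintype ι]

lemma apply_self_ne_zero_of_orthogonal_basis (hnd : ∀ u, (∀ v, B u v = 0) → u = 0)
    (f : Basis ι ℝ V) (hf : ∀ i j, i ≠ j → B (f i) (f j) = 0) (i : ι) :
    B (f i) (f i) ≠ 0 := by
  intro h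
  refine f.ne_zero i (hnd _ fun v => ?_)
  rw [← f.sum_repr v, map_sum]
  refine Finset.sum_eq_zero fun j _ => ?_
  rw [map_smul]
  by_cases hij : i = j
  · subst hij; simp [h]
  · simp [hf i j hij]

lemma repr_orthogonal_basis (hnd : ∀ u, (∀ v, B u v = 0) → u = 0)
    (f : Basis ι ℝ V) (hf : ∀ i j, i ≠ j → B (f i) (f j) = 0) (v : V) (i : ι) :
    f.repr v i = (B (f i) (f i))⁻¹ * B v (f i) := by
  classical
  have h : B v (f i) = f.repr v i * B (f i) (f i) := by
    conv_lhs => rw [← f.sum_repr v]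
    rw [map_sum, LinearMap.sum_apply, Finset.sum_eq_single i]
    · simp
    · intro j _ hj; simp [hf j i hj]
    · simp
  rw [h]
  field_simp [apply_self_ne_zero_of_orthogonal_basis hnd f hf i]

lemma apply_eq_sum_orthogonal_basis (hnd : ∀ u, (∀ v, B u v = 0) → u = 0)
    (f : Basis ι ℝ V) (hf : ∀ i j, i ≠ j → B (f i) (f j) = 0) (u v : V) :
    B u v = ∑ i, (B (f i) (f i))⁻¹ * (B u (f i) * B v (f i)) := by
  conv_lhs => rw [← f.sum_repr v]
  rw [map_sum]
  refine Finset.sum_congr rfl fun i _ => ?_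
  rw [map_smul, smul_eq_mul, repr_orthogonal_basis hnd f hf]
  ring

lemma trace_eq_sum_orthogonal_basis (hnd : ∀ u, (∀ v, B u v = 0) → u = 0)
    (f : Basis ι ℝ V) (hf : ∀ i j, i ≠ j → B (f i) (f j) = 0) (A : Module.End ℝ V) :
    LinearMap.trace ℝ V A = ∑ i, (B (f i) (f i))⁻¹ * B (A (f i)) (f i) := by
  classical
  rw [LinearMap.trace_eq_matrix_trace ℝ f, Matrix.trace]
  refine Finset.sum_congr rfl fun i _ => ?_
  rw [Matrix.diag_apply, LinearMap.toMatrix_apply, repr_orthogonal_basis hnd f hf]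

/-- An orthogonal family of non-isotropic vectors extends to an orthogonal basis by vectors of
square `±1`. -/
lemma exists_orthogonal_basis_extension [Module.Finite ℝ V] (hsymm : ∀ u v, B u v = B v u)
    (hnd : ∀ u, (∀ v, B u v = 0) → u = 0)
    (f : ι → V) (hf : ∀ i j, i ≠ j → B (f i) (f j) = 0) (hf0 : ∀ i, B (f i) (f i) ≠ 0) :
    ∃ (k : ℕ) (b : Basis (ι ⊕ Fin k) ℝ V), (∀ i, b (Sum.inl i) = f i) ∧
      (∀ i j, i ≠ j → B (b i) (b j) = 0) ∧
      ∀ i, B (b (Sum.inr i)) (b (Sum.inr i)) = 1 ∨ B (b (Sum.inr i)) (b (Sum.inr i)) = -1 := by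
  classical
  let W : Submodule ℝ V := ⨅ i, LinearMap.ker (B (f i))
  have hW : ∀ v, v ∈ W ↔ ∀ i, B (f i) v = 0 := fun v => by simp [W]
  let p : V → V := fun v => ∑ i, ((B (f i) (f i))⁻¹ * B v (f i)) • f i
  have hp : ∀ v, v - p v ∈ W := by
    intro v
    rw [hW]
    intro i
    simp only [p, map_sub, map_sum, map_smul, smul_eq_mul]
    rw [Finset.sum_eq_single i]
    · rw [hsymm v]; field_simp [hf0 i]; ring
    · intro j _ hj; rw [hf i j (Ne.symm hj), mul_zero]
    · simp
  let BW : LinearMap.BilinForm ℝ W := LinearMap.BilinForm.restrict B W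
  have hBW : ∀ x y : W, BW x y = B x y := fun x y => rfl
  obtain ⟨g, hg⟩ := LinearMap.BilinForm.exists_orthogonal_basis (B := BW)
    ⟨fun x y => by simp [hBW, hsymm (x : V) y]⟩
  have hg' : ∀ i j, i ≠ j → B (g i) (g j) = 0 := fun i j h => hg h
  have hgf : ∀ i (w : W), B w (f i) = 0 := fun i w => by
    rw [hsymm]; exact (hW w).1 w.2 i
  have hg0 : ∀ i, B (g i) (g i) ≠ 0 := by
    refine apply_self_ne_zero_of_orthogonal_basis (B := BW) ?_ g hg'
    intro u hu
    refine Subtype.ext (hnd _ fun v => ?_)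
    have h1 : B u (v - p v) = 0 := hu ⟨_, hp v⟩
    have h2 : B u (p v) = 0 := by
      simp only [p, map_sum, map_smul, hgf, smul_zero, Finset.sum_const_zero]
    rw [← sub_add_cancel v (p v), map_add, h1, h2, add_zero]
  let c : Fin (finrank ℝ W) → ℝ := fun i => (√|B (g i) (g i)|)⁻¹
  have hc : ∀ i, c i ≠ 0 := fun i => inv_ne_zero (Real.sqrt_ne_zero'.2 (abs_pos.2 (hg0 i)))
  let g' : Basis (Fin (finrank ℝ W)) ℝ W := g.isUnitSMul (fun i => (hc i).isUnit)
  have hg'_apply : ∀ i, (g' i : V) = c i • (g i : V) := fun i => by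
    simp [g', Basis.isUnitSMul_apply]
  have hnorm : ∀ i, B (g' i) (g' i) = 1 ∨ B (g' i) (g' i) = -1 := by
    intro i
    have h1 : B (g' i) (g' i) = c i ^ 2 * B (g i) (g i) := by
      rw [hg'_apply]; simp; ring
    have h2 : c i ^ 2 = |B (g i) (g i)|⁻¹ := by
      simp only [c, inv_pow, Real.sq_sqrt (abs_nonneg _)]
    rw [h1, h2]
    rcases lt_or_gt_of_ne (hg0 i) with h | h
    · right; rw [abs_of_neg h, inv_neg, neg_mul, inv_mul_cancel₀ (hg0 i)]
    · left; rw [abs_of_pos h, inv_mul_cancel₀ (hg0 i)]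
  let F : ι ⊕ Fin (finrank ℝ W) → V := Sum.elim f (fun i => (g' i : V))
  have hF : ∀ i j, i ≠ j → B (F i) (F j) = 0 := by
    rintro (i | i) (j | j) hij
    · exact hf i j fun h => hij (by rw [h])
    · exact (hW _).1 (g' j).2 i
    · exact hgf j (g' i)
    · simp only [F, Sum.elim_inr, hg'_apply, map_smul, LinearMap.smul_apply]
      rw [hg' i j fun h => hij (by rw [h])]; simp
  have hF0 : ∀ i, B (F i) (F i) ≠ 0 := by
    rintro (i | i)
    · exact hf0 i
    · rcases hnorm i with h | h <;> simp [F, h]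
  have hli : LinearIndependent ℝ F :=
    LinearMap.linearIndependent_of_isOrthoᵢ (B := B) (fun i j h => hF i j h) hF0
  have hspan : ⊤ ≤ Submodule.span ℝ (Set.range F) := by
    intro v _
    rw [← sub_add_cancel v (p v)]
    refine add_mem ?_ (sum_mem fun i _ =>
      Submodule.smul_mem _ _ (Submodule.subset_span ⟨Sum.inl i, rfl⟩))
    have : v - p v = ∑ i, g'.repr ⟨_, hp v⟩ i • (g' i : V) := by
      have h := congrArg W.subtype (g'.sum_repr ⟨v - p v, hp v⟩)
      rw [map_sum] at h
      exact h.symm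
    rw [this]
    exact sum_mem fun i _ => Submodule.smul_mem _ _ (Submodule.subset_span ⟨Sum.inr i, rfl⟩)
  refine ⟨_, Basis.mk hli hspan, fun i => by simp [F], fun i j h => by simpa using hF i j h,
    fun i => by simpa [F] using hnorm i⟩

end Bilinear

/-- A symmetric form which is negative on some line and positive definite on its orthogonal. -/
structure IsLorentzForm {V : Type*} [AddCommGroup V] [Module ℝ V]
    (B : V →ₗ[ℝ] V →ₗ[ℝ] ℝ) : Prop where
  symm : ∀ u v, B u v = B v u
  exists_timelike : ∃ t, B t t < 0 ∧ ∀ v, B v t = 0 → v ≠ 0 → 0 < B v v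

namespace IsLorentzForm

variable {V : Type*} [AddCommGroup V] [Module ℝ V] {B : V →ₗ[ℝ] V →ₗ[ℝ] ℝ}

lemma pos_of_orthogonal_timelike (hB : IsLorentzForm B) {t v : V} (ht : B t t < 0)
    (hv : B v t = 0) (hv0 : v ≠ 0) : 0 < B v v := by
  obtain ⟨t₀, ht₀, hpos⟩ := hB.exists_timelike
  by_contra! hvv
  set x := B v t₀ • t - B t t₀ • v with hx
  have hxt : B x t₀ = 0 := by simp [hx]; ring
  have hxx : B x x = B v t₀ ^ 2 * B t t + B t t₀ ^ 2 * B v v := by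
    simp [hx, hv, hB.symm t v]; ring
  have hx0 : x = 0 := by
    by_contra h
    have := hpos x hxt h
    nlinarith [mul_nonneg (sq_nonneg (B v t₀)) (neg_nonneg.2 ht.le),
      mul_nonneg (sq_nonneg (B t t₀)) (neg_nonneg.2 hvv)]
  have h1 : B x t = 0 := by simp [hx0]
  have h2 : B x t = B v t₀ * B t t := by simp [hx, hv]
  have h3 : B v t₀ = 0 := by
    rcases mul_eq_zero.1 (h2.symm.trans h1) with h | h
    · exact h
    · exact absurd h ht.ne
  exact absurd (hpos v h3 hv0) (not_lt.2 hvv)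

lemma nonneg_of_orthogonal_timelike (hB : IsLorentzForm B) {t v : V} (ht : B t t < 0)
    (hv : B v t = 0) : 0 ≤ B v v := by
  by_cases h : v = 0
  · simp [h]
  · exact (hB.pos_of_orthogonal_timelike ht hv h).le

lemma apply_ne_zero_of_null (hB : IsLorentzForm B) {t e : V} (ht : B t t < 0)
    (he : B e e = 0) (he0 : e ≠ 0) : B e t ≠ 0 := fun h =>
  (hB.pos_of_orthogonal_timelike ht h he0).ne' he

lemma nonneg_of_orthogonal_null (hB : IsLorentzForm B) {e v : V} (he : B e e = 0)
    (he0 : e ≠ 0) (hv : B v e = 0) : 0 ≤ B v v ∧ (B v v ≤ 0 → ∃ μ : ℝ, v = μ • e) := by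
  obtain ⟨t, ht, hpos⟩ := hB.exists_timelike
  have het := hB.apply_ne_zero_of_null ht he he0
  set x := v - (B v t / B e t) • e with hx
  have hxt : B x t = 0 := by simp [hx]; field_simp; ring
  have hxx : B x x = B v v := by simp [hx, he, hv, hB.symm e v]
  refine ⟨hxx ▸ hB.nonneg_of_orthogonal_timelike ht hxt, fun h => ⟨B v t / B e t, ?_⟩⟩
  by_contra h'
  have := hpos x hxt (sub_ne_zero.2 h')
  linarith

end IsLorentzForm

lemma IsLorentzianForm.isLorentzForm {V : Type*} [AddCommGroup V] [Module ℝ V]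
    {B : V →ₗ[ℝ] V →ₗ[ℝ] ℝ} (hsymm : ∀ u v, B u v = B v u)
    (hnd : ∀ u, (∀ v, B u v = 0) → u = 0) (h : IsLorentzianForm B) : IsLorentzForm B := by
  obtain ⟨n, b, hb, hb0, hb1⟩ := h
  refine ⟨hsymm, b 0, by rw [hb0]; norm_num, fun v hv hv0 => ?_⟩
  have hsum : B v v = ∑ i, B v (b i) ^ 2 := by
    rw [apply_eq_sum_orthogonal_basis hnd b hb]
    refine Finset.sum_congr rfl fun i _ => ?_
    by_cases hi : i = 0
    · subst hi; simp [hv]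
    · rw [hb1 i hi]; ring
  rw [hsum]
  refine lt_of_le_of_ne (Finset.sum_nonneg fun i _ => sq_nonneg _) fun h0 => hv0 ?_
  have h1 := (Finset.sum_eq_zero_iff_of_nonneg fun i _ => sq_nonneg (B v (b i))).1 h0.symm
  refine b.repr.injective (Finsupp.ext fun i => ?_)
  rw [repr_orthogonal_basis hnd b hb, pow_eq_zero_iff two_ne_zero |>.1 (h1 i (by simp))]
  simp

section StructureConstants

variable {ι : Type*} [Fintype ι] {x q : ι → ℝ} {φ : ι → ι → ι → ℝ} {lam : ℝ}
  {o : ι}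

lemma einstein_constant_nonneg (hq : ∀ k, 0 ≤ q k)
    (hC : ∀ k, ∑ i, ∑ j, φ k i j ^ 2 = 4 * lam * x k + 2 * x k ^ 2)
    (hM : ∀ k, ∑ j, ∑ l, (x l)⁻¹ * φ l k j ^ 2 + q k + x k = -2 * lam)
    (hZ : 2 * ∑ k, x k + ∑ k, q k = 4 * lam) :
    0 ≤ lam ∧ ∃ r : ℝ, 0 ≤ r ∧ ∑ k, x k = -(r * lam) := by
  have hS : ∑ k, ∑ j, ∑ l, (x l)⁻¹ * φ l k j ^ 2
      = ∑ k, (x k)⁻¹ * ∑ i, ∑ j, φ k i j ^ 2 := by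
    simp only [Finset.mul_sum]
    rw [Finset.sum_congr rfl fun k _ => Finset.sum_comm, Finset.sum_comm]
  have hS' : ∑ k, (x k)⁻¹ * ∑ i, ∑ j, φ k i j ^ 2
      = 4 * lam * ∑ k, (if x k = 0 then (0 : ℝ) else 1) + 2 * ∑ k, x k := by
    rw [Finset.mul_sum, Finset.mul_sum, ← Finset.sum_add_distrib]
    refine Finset.sum_congr rfl fun k _ => ?_
    rw [hC]
    split_ifs with h
    · simp [h]
    · field_simp
  have hsum : ∑ k, (∑ j, ∑ l, (x l)⁻¹ * φ l k j ^ 2 + q k + x k)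
      = ∑ _k : ι, (-2 * lam) := Finset.sum_congr rfl fun k _ => hM k
  rw [Finset.sum_add_distrib, Finset.sum_add_distrib, hS, hS', Finset.sum_const,
    nsmul_eq_mul] at hsum
  have hc : 0 ≤ ∑ k, (if x k = 0 then (0 : ℝ) else 1) :=
    Finset.sum_nonneg fun k _ => by split_ifs <;> norm_num
  have hm : (0 : ℝ) ≤ (Finset.univ : Finset ι).card := Nat.cast_nonneg _
  have hQ : 0 ≤ ∑ k, q k := Finset.sum_nonneg fun k _ => hq k
  set c := ∑ k, (if x k = 0 then (0 : ℝ) else 1)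
  set m : ℝ := ((Finset.univ : Finset ι).card : ℝ)
  have hp : ∑ k, x k = -((2 * m + 4 * c + 4) * lam) := by linarith
  refine ⟨?_, 2 * m + 4 * c + 4, by positivity, hp⟩
  by_contra! h
  nlinarith [mul_nonneg hm (neg_nonneg.2 h.le), mul_nonneg hc (neg_nonneg.2 h.le)]

lemma structure_constants_vanish [DecidableEq ι]
    (hskew : ∀ k i j, φ k i j = -φ k j i) (hφ0 : ∀ k i j, x k = 0 → φ k i j = 0)
    (hq : ∀ k, 0 ≤ q k) (hq0 : ∀ k, x k ≠ 0 → q k = 0)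
    (hC : ∀ k, ∑ i, ∑ j, φ k i j ^ 2 = 4 * lam * x k + 2 * x k ^ 2)
    (hM : ∀ k, ∑ j, ∑ l, (x l)⁻¹ * φ l k j ^ 2 + q k + x k = -2 * lam)
    (hZ : 2 * ∑ k, x k + ∑ k, q k = 4 * lam)
    (ho : x o < 0) (hpos : ∀ k, k ≠ o → 0 ≤ x k) :
    lam = 0 ∧ (∀ k, q k = 0) ∧ ∑ k, x k = 0 ∧ (∀ j, φ o o j = 0) ∧
      ∀ l i j, l ≠ o → i ≠ o → j ≠ o → φ l i j = 0 := by
  obtain ⟨hlam, r, hr, hp⟩ := einstein_constant_nonneg hq hC hM hZ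
  have hdiag : ∀ k i, φ k i i = 0 := fun k i => by linarith [hskew k i i]
  set I := (Finset.univ : Finset ι).erase o
  have hI : ∀ k, k ∈ I ↔ k ≠ o := fun k => by simp [I]
  have hs : ∀ f : ι → ℝ, ∑ k, f k = f o + ∑ k ∈ I, f k := fun f =>
    (Finset.add_sum_erase _ f (Finset.mem_univ o)).symm
  set A := ∑ l ∈ I, ∑ j ∈ I, (x l)⁻¹ * φ l o j ^ 2
  set E := ∑ l ∈ I, ∑ i ∈ I, ∑ j ∈ I, (x l)⁻¹ * φ l i j ^ 2
  set C := ∑ j ∈ I, φ o o j ^ 2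
  set F := ∑ i ∈ I, ∑ j ∈ I, φ o i j ^ 2
  have hsq : ∀ k i j, φ k i j ^ 2 = φ k j i ^ 2 := fun k i j => by rw [hskew, neg_sq]
  have hX : ∀ k, ∑ i, ∑ j, φ k i j ^ 2
      = 2 * ∑ j ∈ I, φ k o j ^ 2 + ∑ i ∈ I, ∑ j ∈ I, φ k i j ^ 2 := by
    intro k
    rw [hs, hs, hdiag, Finset.sum_congr rfl fun i _ => hs fun j => φ k i j ^ 2,
      Finset.sum_add_distrib, Finset.sum_congr rfl fun i _ => hsq k i o]
    ring
  have hXI : ∑ k ∈ I, (x k)⁻¹ * ∑ i, ∑ j, φ k i j ^ 2 = 2 * A + E := by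
    simp only [A, E, hX]
    rw [Finset.mul_sum, ← Finset.sum_add_distrib]
    refine Finset.sum_congr rfl fun k _ => ?_
    simp only [mul_add, Finset.mul_sum]
    congr 1
    exact Finset.sum_congr rfl fun j _ => by ring
  have hRo : ∑ j, ∑ l, (x l)⁻¹ * φ l o j ^ 2 = (x o)⁻¹ * C + A := by
    rw [hs]
    simp only [hdiag]
    rw [Finset.sum_congr rfl fun j _ => hs fun l => (x l)⁻¹ * φ l o j ^ 2,
      Finset.sum_add_distrib, Finset.sum_comm, ← Finset.mul_sum]
    simp [A, C]
  have hRI : ∑ k ∈ I, ∑ j, ∑ l, (x l)⁻¹ * φ l k j ^ 2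
      = (x o)⁻¹ * (C + F) + A + E := by
    have h1 : ∀ k, ∑ j, ∑ l, (x l)⁻¹ * φ l k j ^ 2 = (x o)⁻¹ * φ o o k ^ 2
        + ∑ l ∈ I, (x l)⁻¹ * φ l o k ^ 2 + (∑ j ∈ I, (x o)⁻¹ * φ o k j ^ 2
        + ∑ l ∈ I, ∑ j ∈ I, (x l)⁻¹ * φ l k j ^ 2) := by
      intro k
      rw [hs, hs, hsq o k o, Finset.sum_congr rfl fun l _ => by rw [hsq l k o],
        Finset.sum_congr rfl fun j _ => hs fun l => (x l)⁻¹ * φ l k j ^ 2,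
        Finset.sum_add_distrib, Finset.sum_comm (s := I)]
    simp only [h1, Finset.sum_add_distrib]
    have h2 : ∑ k ∈ I, ∑ l ∈ I, (x l)⁻¹ * φ l o k ^ 2 = A := Finset.sum_comm
    have h3 : ∑ k ∈ I, ∑ l ∈ I, ∑ j ∈ I, (x l)⁻¹ * φ l k j ^ 2 = E := Finset.sum_comm
    rw [h2, h3]
    simp only [← Finset.mul_sum]
    ring
  set τ : ι → ℝ := fun k =>
    -((x k)⁻¹ * ∑ i, ∑ j, φ k i j ^ 2 + 2 * ∑ j, ∑ l, (x l)⁻¹ * φ l k j ^ 2) with hτ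
  have hτ0 : ∀ k, x k ≠ 0 → τ k = 0 := by
    intro k hk
    have h1 : (x k)⁻¹ * (4 * lam * x k + 2 * x k ^ 2) = 4 * lam + 2 * x k := by field_simp
    simp only [hτ, hC, h1]
    linarith [hM k, hq0 k hk]
  have hτ1 : ∀ k, x k = 0 → τ k = 2 * (2 * lam + q k) := by
    intro k hk
    have := hM k
    simp only [hτ, hk, inv_zero, zero_mul] at this ⊢
    linarith
  have hτnn : ∀ k, 0 ≤ τ k := by
    intro k
    by_cases hk : x k = 0
    · rw [hτ1 k hk]; linarith [hq k]
    · rw [hτ0 k hk]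
  have hτI : ∑ k ∈ I, τ k = -(2 * A + E + 2 * ((x o)⁻¹ * (C + F) + A + E)) := by
    simp only [hτ]
    rw [Finset.sum_neg_distrib, Finset.sum_add_distrib, hXI, ← Finset.mul_sum, hRI]
  have hτo : (x o)⁻¹ * (2 * C + F) + 2 * ((x o)⁻¹ * C + A) = 0 := by
    have := hτ0 o ho.ne
    simp only [hτ, hX, hRo] at this
    linarith
  have hE : 0 ≤ E := Finset.sum_nonneg fun l hl => Finset.sum_nonneg fun i _ =>
    Finset.sum_nonneg fun j _ => mul_nonneg (inv_nonneg.2 (hpos l ((hI l).1 hl))) (sq_nonneg _)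
  have hCnn : 0 ≤ C := Finset.sum_nonneg fun j _ => sq_nonneg _
  have hxo : (x o)⁻¹ < 0 := inv_lt_zero.2 ho
  have hxC : 0 ≤ -((x o)⁻¹ * C) := by nlinarith
  have hτs : 0 ≤ ∑ k ∈ I, τ k := Finset.sum_nonneg fun k _ => hτnn k
  have key : ∑ k ∈ I, τ k + 3 * E + 6 * -((x o)⁻¹ * C) = 0 := by rw [hτI]; linarith
  have hE0 : E = 0 := by linarith
  have hC0 : C = 0 := by
    have : (x o)⁻¹ * C = 0 := by linarith
    exact (mul_eq_zero.1 this).resolve_left hxo.ne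
  have hτs0 : ∑ k ∈ I, τ k = 0 := by linarith
  have hqz : ∀ k, q k = 0 := by
    intro k
    by_cases hk : x k = 0
    · have hkI : k ∈ I := (hI k).2 fun h => ho.ne (h ▸ hk)
      have := (Finset.sum_eq_zero_iff_of_nonneg fun k _ => hτnn k).1 hτs0 k hkI
      rw [hτ1 k hk] at this
      linarith [hq k]
    · exact hq0 k hk
  have hQ : ∑ k, q k = 0 := Finset.sum_eq_zero fun k _ => hqz k
  have hl0 : lam = 0 := by
    rw [hQ, hp] at hZ
    nlinarith [mul_nonneg hr hlam]
  refine ⟨hl0, hqz, by rw [hp, hl0]; ring, fun j => ?_, fun l i j hl hi hj => ?_⟩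
  · by_cases hj : j = o
    · rw [hj, hdiag]
    · exact pow_eq_zero_iff two_ne_zero |>.1
        ((Finset.sum_eq_zero_iff_of_nonneg fun j _ => sq_nonneg (φ o o j)).1 hC0 j ((hI j).2 hj))
  · by_cases hxl : x l = 0
    · exact hφ0 l i j hxl
    · have hnn : ∀ l ∈ I, ∀ i j, 0 ≤ (x l)⁻¹ * φ l i j ^ 2 := fun l hl i j =>
        mul_nonneg (inv_nonneg.2 (hpos l ((hI l).1 hl))) (sq_nonneg _)
      have h1 := (Finset.sum_eq_zero_iff_of_nonneg fun l hl => Finset.sum_nonneg fun i _ =>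
        Finset.sum_nonneg fun j _ => hnn l hl i j).1 hE0 l ((hI l).2 hl)
      have h2 := (Finset.sum_eq_zero_iff_of_nonneg fun i _ =>
        Finset.sum_nonneg fun j _ => hnn l ((hI l).2 hl) i j).1 h1 i ((hI i).2 hi)
      have h3 := (Finset.sum_eq_zero_iff_of_nonneg fun j _ =>
        hnn l ((hI l).2 hl) i j).1 h2 j ((hI j).2 hj)
      simpa [hxl] using h3

lemma lorentzian_structure_constants [DecidableEq ι]
    (hskew : ∀ k i j, φ k i j = -φ k j i) (hcyc : ∀ k i j, φ k i j + φ i j k + φ j k i = 0)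
    (hφ0 : ∀ k i j, x k = 0 → φ k i j = 0)
    (hq : ∀ k, 0 ≤ q k) (hq0 : ∀ k, x k ≠ 0 → q k = 0)
    (hC : ∀ k, ∑ i, ∑ j, φ k i j ^ 2 = 4 * lam * x k + 2 * x k ^ 2)
    (hM : ∀ k, ∑ j, ∑ l, (x l)⁻¹ * φ l k j ^ 2 + q k + x k = -2 * lam)
    (hZ : 2 * ∑ k, x k + ∑ k, q k = 4 * lam)
    (ho : x o < 0) (hpos : ∀ k, k ≠ o → 0 ≤ x k)
    (hcent : ∀ a : ι → ℝ, (∀ k j, ∑ i, a i * φ k i j = 0) →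
      (∀ i, a i ≠ 0 → x i = 0 ∧ q i = 0) → a = 0) :
    lam = 0 ∧ Fintype.card ι = 3 ∧
      ((Finset.univ.filter fun i => x i ≠ 0).card = 2 ∨
        (Finset.univ.filter fun i => x i ≠ 0).card = 3) := by
  obtain ⟨hlam, hqz, hp, hφo, hφI⟩ :=
    structure_constants_vanish hskew hφ0 hq hq0 hC hM hZ ho hpos
  refine ⟨hlam, ?_⟩
  set I := (Finset.univ : Finset ι).erase o
  have hI : ∀ k, k ∈ I ↔ k ≠ o := fun k => by simp [I]
  have hs : ∀ f : ι → ℝ, ∑ k, f k = f o + ∑ k ∈ I, f k := fun f =>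
    (Finset.add_sum_erase _ f (Finset.mem_univ o)).symm
  have hdiag : ∀ k i, φ k i i = 0 := fun k i => by linarith [hskew k i i]
  have hφo' : ∀ j, φ o j o = 0 := fun j => by rw [hskew, hφo, neg_zero]
  set N : ι → ι → ℝ := fun i j => φ i o j with hN
  have hK : ∀ i j, φ o i j = N i j - N j i := fun i j => by
    simp only [hN]; linarith [hcyc o i j, hskew i j o]
  have hrow : ∀ k, k ≠ o → ∑ j ∈ I, N k j ^ 2 = x k ^ 2 := by
    intro k hk
    have h1 := hC k
    rw [hs, hs, hdiag, Finset.sum_congr rfl fun i hi => (show ∑ j, φ k i j ^ 2 = N k i ^ 2 by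
      rw [hs, Finset.sum_eq_zero fun j hj => by
        rw [hφI k i j hk ((hI i).1 hi) ((hI j).1 hj)]; ring, hskew]
      simp [hN])] at h1
    simp only [hN, hlam] at h1 ⊢
    linarith
  have hle : ∀ i j, i ≠ o → j ≠ o → |N i j| ≤ x i := fun i j hi hj =>
    abs_le_of_sq_le_sq ((Finset.single_le_sum (f := fun j => N i j ^ 2)
      (fun j _ => sq_nonneg _) ((hI j).2 hj)).trans (hrow i hi).le) (hpos i hi)
  have hxo : x o = -∑ k ∈ I, x k := by linarith [hs x]
  have hsumK : ∑ i ∈ I, ∑ j ∈ I, (N i j - N j i) ^ 2 = 2 * (∑ k ∈ I, x k) ^ 2 := by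
    have h1 := hC o
    rw [hs, Finset.sum_eq_zero fun j _ => by rw [hφo]; ring,
      Finset.sum_congr rfl fun i _ => (show ∑ j, φ o i j ^ 2 = ∑ j ∈ I, (N i j - N j i) ^ 2 by
      rw [hs, hφo']; simp [hK])] at h1
    rw [hlam, hxo] at h1
    linarith
  set w : ι → ι → ℝ := fun i j => N i j * N j i + if i = j then 0 else x i * x j with hw
  have hwnn : ∀ i ∈ I, ∀ j ∈ I, 0 ≤ w i j := by
    intro i hi j hj
    rw [hI] at hi hj
    simp only [hw]
    split_ifs with h
    · rw [h, add_zero]; exact mul_self_nonneg _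
    · have h1 : |N i j * N j i| ≤ x i * x j := by
        rw [abs_mul]; exact mul_le_mul (hle i j hi hj) (hle j i hj hi) (abs_nonneg _) (hpos i hi)
      linarith [neg_abs_le (N i j * N j i)]
  have hwsum : ∑ i ∈ I, ∑ j ∈ I, w i j = 0 := by
    have h1 : ∑ i ∈ I, ∑ j ∈ I, N i j ^ 2 = ∑ i ∈ I, x i ^ 2 :=
      Finset.sum_congr rfl fun i hi => hrow i ((hI i).1 hi)
    have h2 : ∑ i ∈ I, ∑ j ∈ I, N j i ^ 2 = ∑ i ∈ I, x i ^ 2 := by rw [Finset.sum_comm, h1]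
    have h3 : ∑ i ∈ I, ∑ j ∈ I, (N i j - N j i) ^ 2 = ∑ i ∈ I, ∑ j ∈ I, N i j ^ 2
        + ∑ i ∈ I, ∑ j ∈ I, N j i ^ 2 - 2 * ∑ i ∈ I, ∑ j ∈ I, N i j * N j i := by
      simp only [Finset.mul_sum, ← Finset.sum_add_distrib, ← Finset.sum_sub_distrib]
      exact Finset.sum_congr rfl fun i _ => Finset.sum_congr rfl fun j _ => by ring
    have h4 : ∑ i ∈ I, ∑ j ∈ I, (if i = j then 0 else x i * x j)
        = (∑ k ∈ I, x k) ^ 2 - ∑ i ∈ I, x i ^ 2 := by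
      rw [sq, Finset.sum_mul_sum, ← Finset.sum_sub_distrib]
      refine Finset.sum_congr rfl fun i hi => ?_
      rw [← Finset.add_sum_erase I _ hi, ← Finset.add_sum_erase I (fun j => x i * x j) hi,
        if_pos rfl, Finset.sum_congr rfl fun j hj => if_neg (Finset.ne_of_mem_erase hj).symm]
      ring
    simp only [hw, Finset.sum_add_distrib]
    linarith
  have hw0 : ∀ i j, i ≠ o → j ≠ o → w i j = 0 := fun i j hi hj =>
    (Finset.sum_eq_zero_iff_of_nonneg fun j hj => hwnn i ((hI i).2 hi) j hj).1
      ((Finset.sum_eq_zero_iff_of_nonneg fun i hi => Finset.sum_nonneg fun j hj =>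
        hwnn i hi j hj).1 hwsum i ((hI i).2 hi)) j ((hI j).2 hj)
  have hNii : ∀ i, i ≠ o → N i i = 0 := fun i hi => by
    have := hw0 i i hi hi
    simpa [hw] using this
  have hNx : ∀ i j, i ≠ o → x i = 0 → j ≠ o → N i j = 0 := fun i j hi hxi hj =>
    abs_nonpos_iff.1 (hxi ▸ hle i j hi hj)
  have hfull : ∀ i j, i ≠ o → j ≠ o → i ≠ j → 0 < x i → 0 < x j → N i j ^ 2 = x i ^ 2 := by
    intro i j hi hj hij hxi hxj
    have h1 := hw0 i j hi hj
    simp only [hw, if_neg hij] at h1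
    have h2 : |N i j| * |N j i| = x i * x j := by
      rw [← abs_mul, show N i j * N j i = -(x i * x j) by linarith, abs_neg,
        abs_of_pos (mul_pos hxi hxj)]
    have h3 : |N i j| = x i := by
      refine le_antisymm (hle i j hi hj) ?_
      have := hle j i hj hi
      nlinarith [abs_nonneg (N i j)]
    rw [← sq_abs, h3]
  have htwo : ∀ i j k, i ≠ o → j ≠ o → k ≠ o → j ≠ k → N i j ^ 2 + N i k ^ 2 ≤ x i ^ 2 := by
    intro i j k hi hj hk hjk
    rw [← hrow i hi, ← Finset.sum_pair (f := fun j => N i j ^ 2) hjk]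
    refine Finset.sum_le_sum_of_subset_of_nonneg ?_ fun j _ _ => sq_nonneg _
    intro l hl
    rcases Finset.mem_insert.1 hl with rfl | hl
    · exact (hI _).2 hj
    · rw [Finset.mem_singleton.1 hl]; exact (hI _).2 hk
  have hUo : ∀ u, x u = 0 → u ≠ o := fun u hu h => ho.ne (h ▸ hu)
  have hcent' : ∀ a : ι → ℝ, (∀ i, a i ≠ 0 → x i = 0) →
      (∀ k, k ≠ o → ∑ i, a i * N k i = 0) → a = 0 := by
    intro a ha hak
    refine hcent a (fun k j => ?_) fun i hi => ⟨ha i hi, hqz i⟩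
    by_cases hk : k = o
    · subst hk
      by_cases hj : j = k
      · subst hj
        exact Finset.sum_eq_zero fun i _ => by rw [hφo', mul_zero]
      · rw [← neg_zero, ← hak j hj, ← Finset.sum_neg_distrib]
        refine Finset.sum_congr rfl fun i _ => ?_
        by_cases hi : a i = 0
        · simp [hi]
        · rw [hK, hNx i j (hUo i (ha i hi)) (ha i hi) hj]; ring
    · by_cases hj : j = o
      · subst hj
        rw [← neg_zero, ← hak k hk, ← Finset.sum_neg_distrib]
        refine Finset.sum_congr rfl fun i _ => ?_
        rw [hskew]; simp [hN]
      · refine Finset.sum_eq_zero fun i _ => ?_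
        by_cases hi : a i = 0
        · simp [hi]
        · rw [hφI k i j hk (hUo i (ha i hi)) hj, mul_zero]
  obtain ⟨i, hi, hxi⟩ : ∃ i, i ≠ o ∧ 0 < x i := by
    by_contra! h
    have : ∑ k ∈ I, x k ≤ 0 := Finset.sum_nonpos fun k hk => h k ((hI k).1 hk)
    linarith
  have hcase : ∀ k, k ≠ o → x k = 0 ∨ 0 < x k := fun k hk =>
    (hpos k hk).eq_or_lt.imp Eq.symm id
  by_cases hex : ∃ j, j ≠ o ∧ j ≠ i ∧ 0 < x j
  · obtain ⟨j, hj, hji, hxj⟩ := hex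
    have hU : ∀ u, x u ≠ 0 := by
      intro u hu
      have huo := hUo u hu
      have hz : ∀ k l, k ≠ o → l ≠ o → k ≠ l → 0 < x k → 0 < x l → N k u = 0 := by
        intro k l hk hl hkl hxk hxl
        have h1 := htwo k l u hk hl huo fun h => hxl.ne' (h ▸ hu)
        rw [hfull k l hk hl hkl hxk hxl] at h1
        exact pow_eq_zero_iff two_ne_zero |>.1 (le_antisymm (by linarith) (sq_nonneg _))
      have h1 : (Pi.single u 1 : ι → ℝ) = 0 := by
        refine hcent' _ (fun l hl => ?_) fun k hk => ?_
        · by_contra h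
          exact hl (Pi.single_eq_of_ne (fun h' : l = u => h (by rw [h', hu])) _)
        · rw [Finset.sum_eq_single u (fun l _ hl => by simp [Pi.single_eq_of_ne hl]) (by simp)]
          rcases hcase k hk with hxk | hxk
          · rw [hNx k u hk hxk huo, mul_zero]
          · by_cases hki : k = i
            · rw [hz k j hk hj (hki ▸ hji.symm) hxk hxj, mul_zero]
            · rw [hz k i hk hi hki hxk hxi, mul_zero]
      have := congrFun h1 u
      simp at this
    have huniv : (Finset.univ : Finset ι) = {o, i, j} := by
      ext l
      simp only [Finset.mem_univ, Finset.mem_insert, Finset.mem_singleton, true_iff]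
      by_contra! h
      obtain ⟨hlo, hli, hlj⟩ := h
      have hxl := (hcase l hlo).resolve_left (hU l)
      have h1 := htwo i j l hi hj hlo hlj.symm
      rw [hfull i j hi hj hji.symm hxi hxj, hfull i l hi hlo (Ne.symm hli) hxi hxl] at h1
      nlinarith
    have hcard : Fintype.card ι = 3 := by
      rw [← Finset.card_univ, huniv]
      exact Finset.card_eq_three.2 ⟨o, i, j, hi.symm, hj.symm, hji.symm, rfl⟩
    refine ⟨hcard, Or.inr ?_⟩
    rw [Finset.filter_true_of_mem fun l _ => hU l, Finset.card_univ, hcard]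
  · push Not at hex
    have hxz : ∀ u, u ≠ o → u ≠ i → x u = 0 := fun u huo hui =>
      le_antisymm (hex u huo hui) (hpos u huo)
    obtain ⟨u, huo, hui, hNu⟩ : ∃ u, u ≠ o ∧ u ≠ i ∧ N i u ≠ 0 := by
      by_contra! h
      have h1 := hrow i hi
      rw [Finset.sum_eq_zero fun j hj => ?_] at h1
      · nlinarith
      · by_cases hji : j = i
        · rw [hji, hNii i hi]; ring
        · rw [h j ((hI j).1 hj) hji]; ring
    have huniv : (Finset.univ : Finset ι) = {o, i, u} := by
      ext l
      simp only [Finset.mem_univ, Finset.mem_insert, Finset.mem_singleton, true_iff]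
      by_contra! h
      obtain ⟨hlo, hli, hlu⟩ := h
      have h1 : (Pi.single u (N i l) - Pi.single l (N i u) : ι → ℝ) = 0 := by
        refine hcent' _ (fun k hk => ?_) fun k hk => ?_
        · by_cases hku : k = u
          · rw [hku]; exact hxz u huo hui
          · by_cases hkl : k = l
            · rw [hkl]; exact hxz l hlo hli
            · simp [Pi.single_eq_of_ne hku, Pi.single_eq_of_ne hkl] at hk
        · simp only [Pi.sub_apply, sub_mul, Finset.sum_sub_distrib]
          rw [Finset.sum_eq_single u (fun l _ hl => by simp [Pi.single_eq_of_ne hl]) (by simp),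
            Finset.sum_eq_single l (fun l _ hl => by simp [Pi.single_eq_of_ne hl]) (by simp)]
          simp only [Pi.single_eq_same]
          by_cases hki : k = i
          · rw [hki]; ring
          · rw [hNx k u hk (hxz k hk hki) huo, hNx k l hk (hxz k hk hki) hlo]; ring
      have h2 := congrFun h1 l
      simp [Pi.single_eq_of_ne hlu, hNu] at h2
    refine ⟨?_, Or.inl ?_⟩
    · rw [← Finset.card_univ, huniv]
      exact Finset.card_eq_three.2 ⟨o, i, u, hi.symm, huo.symm, hui.symm, rfl⟩
    · have : (Finset.univ.filter fun l => x l ≠ 0) = {o, i} := by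
        ext l
        simp only [Finset.mem_filter, Finset.mem_univ, true_and, Finset.mem_insert,
          Finset.mem_singleton]
        refine ⟨fun hl => ?_, ?_⟩
        · by_contra! h
          exact hl (hxz l h.1 h.2)
        · rintro (rfl | rfl)
          · exact ho.ne
          · exact hxi.ne'
      rw [this, Finset.card_pair hi.symm]

end StructureConstants

section Ricci

variable {H : Type*} [LieRing H] [LieAlgebra ℝ H] {B : H →ₗ[ℝ] H →ₗ[ℝ] ℝ}
  {ι : Type*} [Fintype ι]

lemma trace_ad_comp_adjoint
    (hnd : ∀ u : H, (∀ v : H, B u v = 0) → u = 0)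
    {adStar : H → Module.End ℝ H} (hadStar : ∀ u v w : H, B (adStar u v) w = B v ⁅u, w⁆)
    (f : Basis ι ℝ H) (hf : ∀ i j, i ≠ j → B (f i) (f j) = 0) (u v : H) :
    LinearMap.trace ℝ H ((LieAlgebra.ad ℝ H u : Module.End ℝ H) ∘ₗ adStar v) =
      ∑ i, (B (f i) (f i))⁻¹ * B ⁅u, f i⁆ ⁅v, f i⁆ := by
  rw [← Module.End.mul_eq_comp, LinearMap.trace_mul_comm,
    trace_eq_sum_orthogonal_basis hnd f hf]
  refine Finset.sum_congr rfl fun i _ => ?_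
  rw [Module.End.mul_apply, hadStar, LieAlgebra.ad_apply]

lemma trace_comp_skew
    (hnd : ∀ u : H, (∀ v : H, B u v = 0) → u = 0)
    {Jm : H → Module.End ℝ H} (hJm : ∀ u v w : H, B (Jm u v) w = B u ⁅v, w⁆)
    (f : Basis ι ℝ H) (hf : ∀ i j, i ≠ j → B (f i) (f j) = 0) (u v : H) :
    LinearMap.trace ℝ H (Jm u ∘ₗ Jm v) =
      -∑ i, ∑ j, (B (f i) (f i))⁻¹ * (B (f j) (f j))⁻¹ *
        (B u ⁅f i, f j⁆ * B v ⁅f i, f j⁆) := by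
  rw [trace_eq_sum_orthogonal_basis hnd f hf, ← Finset.sum_neg_distrib]
  refine Finset.sum_congr rfl fun i _ => ?_
  have h : B (Jm u (Jm v (f i))) (f i) = -B (Jm u (f i)) (Jm v (f i)) := by
    rw [hJm, hJm, ← lie_skew, map_neg]
  rw [LinearMap.comp_apply, h, apply_eq_sum_orthogonal_basis hnd f hf (Jm u (f i)), mul_neg,
    Finset.mul_sum]
  congr 1
  refine Finset.sum_congr rfl fun j _ => ?_
  rw [hJm, hJm]
  ring

end Ricci

/-- A Lorentzian Einstein metric on a 3-step nilpotent Lie algebra with derived algebra `K` and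
nondegenerate center `ℝ z`. -/
structure IsEinsteinNilpotent {H : Type*} [LieRing H] [LieAlgebra ℝ H]
    (B : H →ₗ[ℝ] H →ₗ[ℝ] ℝ) (z : H) (D : Module.End ℝ H) (K : Submodule ℝ H)
    (lam : ℝ) : Prop where
  lorentz : IsLorentzForm B
  nondegenerate : ∀ u, (∀ v, B u v = 0) → u = 0
  unit : B z z = 1 ∨ B z z = -1
  apply_endo : ∀ u v, B (D u) v = B z ⁅u, v⁆
  lie_center : ∀ x : H, ⁅x, z⁆ = 0
  center_mem : z ∈ K
  lie_mem : ∀ x y : H, ⁅x, y⁆ ∈ K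
  orthogonal_of_lie : ∀ m, (∀ x y : H, B m ⁅x, y⁆ = 0) → ∀ k ∈ K, B m k = 0
  lie_derived : ∀ x : H, ∀ k ∈ K, ∃ r : ℝ, ⁅x, k⁆ = r • z
  lie_derived_derived : ∀ k ∈ K, ∀ l ∈ K, ⁅k, l⁆ = 0
  mem_center : ∀ y : H, (∀ x : H, ⁅x, y⁆ = 0) → ∃ r : ℝ, y = r • z
  exists_lie_ne_zero : ∃ k ∈ K, ∃ x : H, ⁅x, k⁆ ≠ 0
  einstein : ∀ {ι : Type} [Fintype ι] (f : Basis ι ℝ H),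
    (∀ i j, i ≠ j → B (f i) (f j) = 0) → ∀ u v,
    -(1 / 2) * ∑ i, (B (f i) (f i))⁻¹ * B ⁅u, f i⁆ ⁅v, f i⁆ +
      (1 / 4) * ∑ i, ∑ j, (B (f i) (f i))⁻¹ * (B (f j) (f j))⁻¹ *
        (B u ⁅f i, f j⁆ * B v ⁅f i, f j⁆) = lam * B u v

namespace IsEinsteinNilpotent

variable {H : Type*} [LieRing H] [LieAlgebra ℝ H] {B : H →ₗ[ℝ] H →ₗ[ℝ] ℝ} {z : H}
  {D : Module.End ℝ H} {K : Submodule ℝ H} {lam : ℝ} {ι : Type} [Fintype ι]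

section

variable (h : IsEinsteinNilpotent B z D K lam)
include h

lemma unit_ne_zero : B z z ≠ 0 := by
  rcases h.unit with h | h <;> rw [h] <;> norm_num

lemma center_lie (x : H) : ⁅z, x⁆ = 0 := by
  rw [← lie_skew, h.lie_center, neg_zero]

lemma endo_skew (u v : H) : B (D u) v = -B u (D v) := by
  rw [h.apply_endo, h.lorentz.symm u, h.apply_endo, ← lie_skew, map_neg]

lemma endo_self (u : H) : B (D u) u = 0 := by
  rw [h.apply_endo, lie_self, map_zero]

lemma endo_center : D z = 0 :=
  h.nondegenerate _ fun v => by rw [h.apply_endo, h.center_lie, map_zero]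

lemma endo_orthogonal_center (u : H) : B (D u) z = 0 := by
  rw [h.apply_endo, h.lie_center, map_zero]

lemma endo_orthogonal {k l : H} (hk : k ∈ K) (hl : l ∈ K) : B (D k) l = 0 := by
  rw [h.apply_endo, h.lie_derived_derived k hk l hl, map_zero]

lemma lie_derived_eq {k : H} (hk : k ∈ K) (x : H) : ⁅k, x⁆ = (B z z * B (D k) x) • z := by
  obtain ⟨r, hr⟩ := h.lie_derived x k hk
  have h1 : ⁅k, x⁆ = (-r) • z := by rw [← lie_skew, hr, neg_smul]
  rw [h.apply_endo, h1, map_smul, smul_eq_mul]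
  congr 1
  rcases h.unit with h | h <;> rw [h] <;> ring

lemma eq_smul_of_endo_eq_zero {k : H} (hk : k ∈ K) (h0 : D k = 0) : ∃ r : ℝ, k = r • z :=
  h.mem_center k fun x => by
    rw [← lie_skew, h.lie_derived_eq hk, h0]; simp

lemma eq_zero_of_endo_eq_zero {k : H} (hk : k ∈ K) (hkz : B k z = 0) (h0 : D k = 0) : k = 0 := by
  obtain ⟨r, hr⟩ := h.eq_smul_of_endo_eq_zero hk h0
  rw [hr, map_smul, LinearMap.smul_apply, smul_eq_mul] at hkz
  rw [hr, (mul_eq_zero.1 hkz).resolve_right h.unit_ne_zero, zero_smul]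

lemma exists_endo_ne_zero : ∃ k ∈ K, B k z = 0 ∧ D k ≠ 0 := by
  obtain ⟨k, hk, x, hx⟩ := h.exists_lie_ne_zero
  refine ⟨k - (B k z / B z z) • z, K.sub_mem hk (K.smul_mem _ h.center_mem), ?_, ?_⟩
  · have := h.unit_ne_zero
    simp
    field_simp
    ring
  · intro h0
    rw [map_sub, map_smul, h.endo_center, smul_zero, sub_zero] at h0
    rw [← lie_skew, h.lie_derived_eq hk, h0] at hx
    simp at hx

/-- The Einstein equation paired with an element of the derived algebra. -/
lemma einstein_derived (f : Basis ι ℝ H) (hf : ∀ i j, i ≠ j → B (f i) (f j) = 0) {k : H}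
    (hk : k ∈ K) (v : H) :
    -(1 / 2) * (B z z * B (D k) (D v)) +
      (1 / 4) * ∑ i, ∑ j, (B (f i) (f i))⁻¹ * (B (f j) (f j))⁻¹ *
        (B k ⁅f i, f j⁆ * B v ⁅f i, f j⁆) = lam * B k v := by
  rw [← h.einstein f hf, apply_eq_sum_orthogonal_basis h.nondegenerate f hf (D k), Finset.mul_sum]
  congr 2
  refine Finset.sum_congr rfl fun i _ => ?_
  rw [h.lie_derived_eq hk, map_smul, LinearMap.smul_apply, smul_eq_mul, h.apply_endo v]
  ring

lemma einstein_orthogonal (f : Basis ι ℝ H) (hf : ∀ i j, i ≠ j → B (f i) (f j) = 0) {u : H}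
    (hu : ∀ k ∈ K, B u k = 0) (v : H) :
    ∑ i, (B (f i) (f i))⁻¹ * B ⁅u, f i⁆ ⁅v, f i⁆ = -2 * lam * B u v := by
  have := h.einstein f hf u v
  simp only [hu _ (h.lie_mem _ _), zero_mul, mul_zero, Finset.sum_const_zero, add_zero] at this
  linarith

lemma unit_eq_one [Module.Finite ℝ H] : B z z = 1 := by
  refine h.unit.resolve_right fun hz => ?_
  obtain ⟨n, f, hfz, hf, -⟩ := exists_orthogonal_basis_extension (ι := Unit) h.lorentz.symm
    h.nondegenerate (fun _ => z) (fun i j hij => absurd rfl hij) (fun _ => h.unit_ne_zero)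
  have hzneg : B z z < 0 := by rw [hz]; norm_num
  have hpos : ∀ i, 0 < B (f (Sum.inr i)) (f (Sum.inr i)) := fun i =>
    h.lorentz.pos_of_orthogonal_timelike hzneg
      (by rw [← hfz ()]; exact hf _ _ (by simp)) (f.ne_zero _)
  have hnonneg : ∀ k, 0 ≤ ∑ i, ∑ j, (B (f i) (f i))⁻¹ * (B (f j) (f j))⁻¹ *
      (B k ⁅f i, f j⁆ * B k ⁅f i, f j⁆) := by
    intro k
    refine Finset.sum_nonneg fun i _ => Finset.sum_nonneg fun j _ => ?_
    rcases i with i | i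
    · rw [hfz, h.center_lie]; simp
    rcases j with j | j
    · rw [hfz, h.lie_center]; simp
    · exact mul_nonneg (mul_nonneg (inv_nonneg.2 (hpos i).le) (inv_nonneg.2 (hpos j).le))
        (mul_self_nonneg _)
  have hlam : lam ≤ 0 := by
    have h1 := h.einstein_derived f hf h.center_mem z
    rw [h.endo_center, map_zero, hz] at h1
    linarith [hnonneg z]
  obtain ⟨k, hk, hkz, hk0⟩ := h.exists_endo_ne_zero
  have h1 := h.einstein_derived f hf hk k
  have h2 := h.lorentz.nonneg_of_orthogonal_timelike hzneg hkz
  have h3 := h.lorentz.pos_of_orthogonal_timelike hzneg (h.endo_orthogonal_center k) hk0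
  rw [hz] at h1
  nlinarith [hnonneg k]

lemma lie_derived_eq' [Module.Finite ℝ H] {k : H} (hk : k ∈ K) (x : H) :
    ⁅k, x⁆ = B (D k) x • z := by
  rw [h.lie_derived_eq hk, h.unit_eq_one, one_mul]

lemma endo_derived_orthogonal [Module.Finite ℝ H] {k u : H} (hk : k ∈ K)
    (hu : ∀ l ∈ K, B u l = 0) : B (D k) (D u) = 0 := by
  obtain ⟨n, f, hfz, hf, -⟩ := exists_orthogonal_basis_extension (ι := Unit) h.lorentz.symm
    h.nondegenerate (fun _ => z) (fun i j hij => absurd rfl hij) (fun _ => h.unit_ne_zero)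
  have h1 := h.einstein_derived f hf hk u
  rw [h.lorentz.symm k u, hu k hk, h.unit_eq_one] at h1
  simp only [hu _ (h.lie_mem _ _), mul_zero, Finset.sum_const_zero] at h1
  linarith

end

end IsEinsteinNilpotent

namespace IsEinsteinNilpotent

variable {H : Type*} [LieRing H] [LieAlgebra ℝ H] [Module.Finite ℝ H] {B : H →ₗ[ℝ] H →ₗ[ℝ] ℝ}
  {z : H} {D : Module.End ℝ H} {K : Submodule ℝ H} {lam : ℝ}

section AdaptedBasis

variable {κ ι : Type} [Fintype κ] [Fintype ι]
  (h : IsEinsteinNilpotent B z D K lam) (f : Basis ((Unit ⊕ κ) ⊕ ι) ℝ H)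
  (hf : ∀ i j, i ≠ j → B (f i) (f j) = 0) (hfz : f (Sum.inl (Sum.inl ())) = z)
  (hfK : ∀ k, f (Sum.inl (Sum.inr k)) ∈ K)
include h hf hfz hfK

lemma einstein_adapted_derived {k : H} (hk : k ∈ K) (hkz : B k z = 0) :
    -(1 / 2) * B (D k) (D k) +
      (1 / 4) * ∑ i, ∑ j, (B (f (Sum.inr i)) (f (Sum.inr i)))⁻¹ *
        (B (f (Sum.inr j)) (f (Sum.inr j)))⁻¹ * B k ⁅f (Sum.inr i), f (Sum.inr j)⁆ ^ 2 =
      lam * B k k := by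
  have h1 : ∀ a ∈ K, ∀ x : H, B k ⁅a, x⁆ = 0 := fun a ha x => by
    rw [h.lie_derived_eq ha, map_smul, hkz, smul_zero]
  have h2 : ∀ a ∈ K, ∀ x : H, B k ⁅x, a⁆ = 0 := fun a ha x => by
    rw [← lie_skew, map_neg, h1 a ha, neg_zero]
  rw [← h.einstein_derived f hf hk k, h.unit_eq_one]
  simp only [Fintype.sum_sum_type, hfz, h1 _ (hfK _), h2 _ (hfK _), h1 _ h.center_mem,
    h2 _ h.center_mem, mul_zero, Finset.sum_const_zero, zero_add, one_mul, pow_two]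

omit [Module.Finite ℝ H] in
lemma apply_endo_endo_adapted (k : κ) :
    B (D (f (Sum.inl (Sum.inr k)))) (D (f (Sum.inl (Sum.inr k)))) =
      ∑ i, (B (f (Sum.inr i)) (f (Sum.inr i)))⁻¹ *
        B (D (f (Sum.inl (Sum.inr k)))) (f (Sum.inr i)) ^ 2 := by
  rw [apply_eq_sum_orthogonal_basis h.nondegenerate f hf]
  simp only [Fintype.sum_sum_type, hfz, h.endo_orthogonal_center,
    h.endo_orthogonal (hfK _) (hfK _), mul_zero, Finset.sum_const_zero, zero_add, pow_two]

lemma einstein_adapted_center :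
    2 * ∑ k, (B (f (Sum.inl (Sum.inr k))) (f (Sum.inl (Sum.inr k))))⁻¹ *
        B (D (f (Sum.inl (Sum.inr k)))) (D (f (Sum.inl (Sum.inr k)))) +
      ∑ i, ∑ j, (B (f (Sum.inr i)) (f (Sum.inr i)))⁻¹ *
        (B (f (Sum.inr j)) (f (Sum.inr j)))⁻¹ * B z ⁅f (Sum.inr i), f (Sum.inr j)⁆ ^ 2 =
      4 * lam := by
  have h1 := h.einstein_derived f hf h.center_mem z
  have h2 : ∀ i k, B (D (f (Sum.inr i))) (f (Sum.inl (Sum.inr k))) =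
      -B (D (f (Sum.inl (Sum.inr k)))) (f (Sum.inr i)) := fun i k => by
    rw [h.endo_skew, h.lorentz.symm]
  rw [h.endo_center, h.unit_eq_one] at h1
  simp only [← h.apply_endo, Fintype.sum_sum_type, hfz, h.endo_orthogonal_center, h.endo_center,
    h.endo_orthogonal (hfK _) (hfK _), mul_zero, Finset.sum_const_zero, zero_add, add_zero,
    map_zero, LinearMap.zero_apply, h2, Finset.sum_add_distrib] at h1
  rw [Finset.sum_comm (s := (Finset.univ : Finset ι)) (t := (Finset.univ : Finset κ)),
    ← add_assoc, ← Finset.sum_add_distrib] at h1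
  rw [Finset.sum_congr rfl fun k _ => (?_ : _ =
    2 * ((B (f (Sum.inl (Sum.inr k))) (f (Sum.inl (Sum.inr k))))⁻¹ *
        B (D (f (Sum.inl (Sum.inr k)))) (D (f (Sum.inl (Sum.inr k))))))] at h1
  · simp only [← Finset.mul_sum, ← h.apply_endo, pow_two] at h1 ⊢
    linarith
  · rw [h.apply_endo_endo_adapted f hf hfz hfK, ← Finset.sum_add_distrib, Finset.mul_sum,
      Finset.mul_sum]
    refine Finset.sum_congr rfl fun i _ => ?_
    ring

lemma einstein_adapted_orthogonal (hfM : ∀ i, ∀ k ∈ K, B (f (Sum.inr i)) k = 0)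
    {u : H} (hu : ∀ k ∈ K, B u k = 0) :
    ∑ k, (B (f (Sum.inl (Sum.inr k))) (f (Sum.inl (Sum.inr k))))⁻¹ *
        B (D (f (Sum.inl (Sum.inr k)))) u ^ 2 +
      ∑ j, (B (f (Sum.inr j)) (f (Sum.inr j)))⁻¹ * (B z ⁅u, f (Sum.inr j)⁆ ^ 2 +
        ∑ k, (B (f (Sum.inl (Sum.inr k))) (f (Sum.inl (Sum.inr k))))⁻¹ *
          B (f (Sum.inl (Sum.inr k))) ⁅u, f (Sum.inr j)⁆ ^ 2) = -2 * lam * B u u := by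
  have h1 := h.einstein_orthogonal f hf hu u
  have h2 : ∀ a ∈ K, B ⁅u, a⁆ ⁅u, a⁆ = B (D a) u ^ 2 := fun a ha => by
    rw [← lie_skew, h.lie_derived_eq' ha]
    simp [h.unit_eq_one, pow_two]
  have h3 : ∀ x ∈ K, B x x = B z x ^ 2 +
      ∑ k, (B (f (Sum.inl (Sum.inr k))) (f (Sum.inl (Sum.inr k))))⁻¹ *
          B (f (Sum.inl (Sum.inr k))) x ^ 2 := fun x hx => by
    rw [apply_eq_sum_orthogonal_basis h.nondegenerate f hf]
    simp only [Fintype.sum_sum_type, hfz, h.lorentz.symm x, hfM _ x hx, mul_zero,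
      Finset.sum_const_zero, add_zero, pow_two, h.unit_eq_one, inv_one, one_mul]
    simp
  simp only [Fintype.sum_sum_type, hfz, h2 _ h.center_mem, h2 _ (hfK _), h.endo_center] at h1
  simp only [h3 _ (h.lie_mem _ _)] at h1
  simpa using h1

end AdaptedBasis

end IsEinsteinNilpotent

section Orthogonal

variable {V : Type*} [AddCommGroup V] [Module ℝ V] [Module.Finite ℝ V]
  {B : V →ₗ[ℝ] V →ₗ[ℝ] ℝ} {K : Submodule ℝ V}

lemma mem_of_forall_orthogonal (hsymm : ∀ u v, B u v = B v u)
    (hnd : ∀ u, (∀ v, B u v = 0) → u = 0) {v : V}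
    (hv : ∀ u, (∀ k ∈ K, B u k = 0) → B u v = 0) : v ∈ K := by
  have hB : LinearMap.IsRefl B := fun x y hxy => by rw [hsymm, hxy]
  have hB' : LinearMap.Nondegenerate B := ⟨hnd, fun u hu => hnd u fun v => by rw [hsymm, hu]⟩
  rw [← LinearMap.BilinForm.orthogonal_orthogonal (B := B) hB' hB K]
  exact fun u hu => hv u fun k hk => by rw [hsymm]; exact hu k hk

lemma exists_orthogonal_projection (hsymm : ∀ u v, B u v = B v u)
    (hK : ∀ k ∈ K, (∀ l ∈ K, B k l = 0) → k = 0) :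
    ∃ P : Module.End ℝ V, (∀ u, P u ∈ K) ∧ ∀ u, ∀ k ∈ K, B (P u) k = B u k := by
  have hB : LinearMap.IsRefl B := fun x y hxy => by rw [hsymm, hxy]
  have hsep : ∀ k : K, (∀ l : K, LinearMap.BilinForm.restrict B K k l = 0) → k = 0 :=
    fun k hk => Subtype.ext (hK k k.2 fun l hl => hk ⟨l, hl⟩)
  have hc : IsCompl K (LinearMap.BilinForm.orthogonal B K) :=
    LinearMap.BilinForm.isCompl_orthogonal_of_restrict_nondegenerate hB
      ⟨hsep, fun k hk => hsep k fun l => by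
        rw [← hk l]; exact hsymm _ _⟩
  refine ⟨K.projection _ hc, fun u => Submodule.projection_apply_mem hc u, fun u k hk => ?_⟩
  conv_rhs => rw [← Submodule.projection_add_projection_eq_self hc u]
  have : B (Submodule.projection _ _ hc.symm u) k = 0 := by
    rw [hsymm]; exact Submodule.projection_apply_mem hc.symm u k hk
  rw [map_add, LinearMap.add_apply, this, add_zero]

end Orthogonal

namespace IsLorentzForm

variable {V : Type*} [AddCommGroup V] [Module ℝ V] {B : V →ₗ[ℝ] V →ₗ[ℝ] ℝ}

/-- The Cauchy–Schwarz inequality on the orthogonal of a timelike vector. -/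
lemma sq_apply_le_of_orthogonal_timelike (hB : IsLorentzForm B) {t u v : V} (ht : B t t < 0)
    (hu : B u t = 0) (hv : B v t = 0) : B u v ^ 2 ≤ B u u * B v v := by
  have h : ∀ r : ℝ, 0 ≤ B v v * (r * r) + 2 * B u v * r + B u u := fun r => by
    have h1 := hB.nonneg_of_orthogonal_timelike (v := u + r • v) ht (by simp [hu, hv])
    simp only [map_add, map_smul, LinearMap.add_apply, LinearMap.smul_apply, smul_eq_mul,
      hB.symm v u] at h1
    linarith
  have := discrim_le_zero h
  rw [discrim] at this
  linarith

/-- A null vector of a semidefinite subspace lies in its radical. -/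
lemma apply_eq_zero_of_nonneg (hB : IsLorentzForm B) {K : Submodule ℝ V}
    (hK : ∀ k ∈ K, 0 ≤ B k k) {e k : V} (he : e ∈ K) (hee : B e e = 0) (hk : k ∈ K) :
    B e k = 0 := by
  have h : ∀ r : ℝ, 0 ≤ 0 * (r * r) + 2 * B e k * r + B k k := fun r => by
    have h1 := hK _ (K.add_mem (K.smul_mem r he) hk)
    simp only [map_add, map_smul, LinearMap.add_apply, LinearMap.smul_apply, smul_eq_mul,
      hB.symm k e, hee] at h1
    linarith
  have := discrim_le_zero h
  rw [discrim] at this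
  nlinarith [sq_nonneg (B e k)]

end IsLorentzForm

lemma sum_eq_of_einstein_traces {κ ι : Type*} [Fintype κ] [Fintype ι] {γ X : κ → ℝ} {η : ι → ℝ}
    {Y : κ → ι → ℝ} {β : ι → ι → ℝ} {s : κ → ι → ι → ℝ} {lam : ℝ}
    (hγ : ∀ k, γ k ≠ 0) (hη : ∀ i, η i ≠ 0) (hX : ∀ k, X k = ∑ i, (η i)⁻¹ * Y k i)
    (hC : ∀ k, -(1 / 2) * X k + (1 / 4) * ∑ i, ∑ j, (η i)⁻¹ * (η j)⁻¹ * s k i j = lam * γ k)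
    (hM : ∀ i, ∑ k, (γ k)⁻¹ * Y k i + ∑ j, (η j)⁻¹ * (β i j + ∑ k, (γ k)⁻¹ * s k i j) =
      -2 * lam * η i)
    (hZ : 2 * ∑ k, (γ k)⁻¹ * X k + ∑ i, ∑ j, (η i)⁻¹ * (η j)⁻¹ * β i j = 4 * lam) :
    ∑ k, (γ k)⁻¹ * X k = -((2 * Fintype.card ι + 4 * Fintype.card κ + 4) * lam) := by
  have hS : ∑ i, ∑ j, ∑ k, (η i)⁻¹ * ((η j)⁻¹ * ((γ k)⁻¹ * s k i j)) =
      ∑ k, (γ k)⁻¹ * ∑ i, ∑ j, (η i)⁻¹ * (η j)⁻¹ * s k i j := by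
    simp only [Finset.mul_sum]
    rw [Finset.sum_comm' (t' := Finset.univ) (s' := fun _ => Finset.univ) (by simp)]
    rw [Finset.sum_congr rfl fun _ _ => Finset.sum_comm, Finset.sum_comm]
    rw [Finset.sum_congr rfl fun _ _ => Finset.sum_comm,
      Finset.sum_congr rfl fun _ _ => Finset.sum_congr rfl fun _ _ => Finset.sum_congr rfl
        fun _ _ => ?_]
    ring
  have hY : ∑ i, ∑ k, (η i)⁻¹ * ((γ k)⁻¹ * Y k i) = ∑ k, (γ k)⁻¹ * X k := by
    rw [Finset.sum_comm]
    refine Finset.sum_congr rfl fun k _ => ?_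
    rw [hX, Finset.mul_sum]
    exact Finset.sum_congr rfl fun i _ => by ring
  have h1 : ∑ k, (γ k)⁻¹ * (lam * γ k) = Fintype.card κ * lam := by
    rw [Finset.sum_congr rfl fun k _ => (by field_simp [hγ k] : (γ k)⁻¹ * (lam * γ k) = lam)]
    simp
  have h2 : ∑ i, (η i)⁻¹ * (-2 * lam * η i) = -2 * Fintype.card ι * lam := by
    rw [Finset.sum_congr rfl fun i _ =>
      (by field_simp [hη i] : (η i)⁻¹ * (-2 * lam * η i) = -2 * lam)]
    simp
    ring
  simp only [← hC, mul_add, Finset.sum_add_distrib, mul_left_comm _ (-(1 / 2) : ℝ),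
    mul_left_comm _ (1 / 4 : ℝ), ← Finset.mul_sum] at h1
  simp only [← hM, mul_add, Finset.sum_add_distrib, Finset.mul_sum] at h2
  rw [hY, hS] at h2
  simp only [mul_assoc (η _)⁻¹ (η _)⁻¹ (β _ _)] at hZ
  linarith

namespace IsEinsteinNilpotent

variable {H : Type*} [LieRing H] [LieAlgebra ℝ H] [Module.Finite ℝ H] {B : H →ₗ[ℝ] H →ₗ[ℝ] ℝ}
  {z : H} {D : Module.End ℝ H} {K : Submodule ℝ H} {lam : ℝ}
  (h : IsEinsteinNilpotent B z D K lam)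
include h

lemma sq_center_le_of_nonneg (hK : ∀ k ∈ K, 0 ≤ B k k) {x : H} (hx : x ∈ K) :
    B x z ^ 2 ≤ B x x := by
  have h1 := hK _ (K.sub_mem hx (K.smul_mem (B x z) h.center_mem))
  simp only [map_sub, map_smul, LinearMap.sub_apply, LinearMap.smul_apply, smul_eq_mul,
    h.unit_eq_one, h.lorentz.symm z x] at h1
  nlinarith

/-- If the derived algebra is positive definite, then the endomorphism satisfies a length bound
on the timelike vectors orthogonal to the derived algebra. -/
lemma endo_le_of_timelike (hK : ∀ k ∈ K, 0 ≤ B k k) {u : H} (hu : ∀ k ∈ K, B u k = 0)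
    (hut : B u u < 0) : B (D u) (D u) ≤ -2 * lam * B u u := by
  obtain ⟨n, f, hfu, hf, -⟩ := exists_orthogonal_basis_extension (ι := Unit) h.lorentz.symm
    h.nondegenerate (fun _ => u) (fun i j hij => absurd rfl hij) (fun _ => hut.ne)
  rw [← h.einstein_orthogonal f hf hu u, apply_eq_sum_orthogonal_basis h.nondegenerate f hf (D u)]
  refine Finset.sum_le_sum fun i _ => ?_
  rcases i with i | i
  · rw [hfu, h.endo_self, lie_self]; simp
  · have hpos : 0 < B (f (Sum.inr i)) (f (Sum.inr i)) :=
      h.lorentz.pos_of_orthogonal_timelike hut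
        (by rw [← hfu ()]; exact hf _ _ (by simp)) (f.ne_zero _)
    refine mul_le_mul_of_nonneg_left ?_ (inv_nonneg.2 hpos.le)
    rw [h.apply_endo, ← pow_two, h.lorentz.symm z]
    exact h.sq_center_le_of_nonneg hK (h.lie_mem _ _)

lemma exists_timelike_derived_of_nondegenerate
    (hnd : ∀ k ∈ K, B k k = 0 → k = 0) : ∃ k ∈ K, B k k < 0 := by
  by_contra! hK
  have hpos : ∀ k ∈ K, k ≠ 0 → 0 < B k k := fun k hk hk0 =>
    lt_of_le_of_ne (hK k hk) fun h0 => hk0 (hnd k hk h0.symm)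
  obtain ⟨P, hPK, hP⟩ := exists_orthogonal_projection (K := K) h.lorentz.symm
    fun k hk hkl => hnd k hk (hkl k hk)
  have hPM : ∀ u, ∀ k ∈ K, B (u - P u) k = 0 := fun u k hk => by
    rw [map_sub, LinearMap.sub_apply, hP u k hk, sub_self]
  obtain ⟨u, huM, hut⟩ : ∃ u, (∀ k ∈ K, B u k = 0) ∧ B u u < 0 := by
    obtain ⟨t, ht, -⟩ := h.lorentz.exists_timelike
    refine ⟨t - P t, hPM t, ?_⟩
    have h1 := hPM t _ (hPK t)
    have h2 := hP t _ (hPK t)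
    have h3 := hK _ (hPK t)
    simp only [map_sub, LinearMap.sub_apply, h.lorentz.symm (P t) t] at h1 ⊢
    linarith
  have hDu : ∀ v, B v v < 0 → 0 ≤ B (D v) (D v) := fun v hv =>
    h.lorentz.nonneg_of_orthogonal_timelike hv (h.endo_self v)
  have hlam0 : 0 ≤ lam := by nlinarith [hDu u hut, h.endo_le_of_timelike hK huM hut]
  rcases hlam0.eq_or_lt with hlam | hlam
  · have hD : ∀ v, (∀ k ∈ K, B v k = 0) → B v v < 0 → D v = 0 := fun v hvM hv => by
      by_contra hv0
      have h1 := h.lorentz.pos_of_orthogonal_timelike hv (h.endo_self v) hv0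
      have h2 := h.endo_le_of_timelike hK hvM hv
      rw [← hlam] at h2
      linarith
    have hDM : ∀ m, (∀ k ∈ K, B m k = 0) → D m = 0 := fun m hm => by
      set m' := m - (B m u / B u u) • u with hm'
      have hm'u : B m' u = 0 := by
        simp only [hm', map_sub, map_smul, LinearMap.sub_apply, LinearMap.smul_apply, smul_eq_mul]
        field_simp [hut.ne]
        ring
      have hp := h.lorentz.nonneg_of_orthogonal_timelike hut hm'u
      set r : ℝ := 1 + B m' m' / -B u u with hr
      have h1 : D (r • u + m') = 0 := by
        refine hD _ (fun k hk => ?_) ?_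
        · simp [hm', hm k hk, huM k hk]
        · have h2 : B (r • u + m') (r • u + m') = r ^ 2 * B u u + B m' m' := by
            simp only [map_add, map_smul, LinearMap.add_apply, LinearMap.smul_apply, smul_eq_mul,
              hm'u, h.lorentz.symm u m']
            ring
          have h3 : r * -B u u = -B u u + B m' m' := by
            rw [hr]; field_simp [hut.ne]; ring
          have h4 : 1 ≤ r := by
            have : 0 ≤ B m' m' / -B u u := div_nonneg hp (by linarith)
            linarith
          rw [h2]
          nlinarith [mul_le_mul_of_nonneg_right h4 (by nlinarith : 0 ≤ r * -B u u)]
      rw [map_add, map_smul, hD u huM hut, smul_zero, zero_add, hm', map_sub, map_smul,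
        hD u huM hut, smul_zero, sub_zero] at h1
      exact h1
    obtain ⟨k, hk, -, hk0⟩ := h.exists_endo_ne_zero
    refine hk0 (h.nondegenerate _ fun v => ?_)
    rw [← sub_add_cancel v (P v), map_add, h.endo_orthogonal hk (hPK v), h.endo_skew,
      hDM _ (hPM v)]
    simp
  · have hbound : ∀ k ∈ K, -2 * lam * B k k ≤ B (D k) (D k) := fun k hk => by
      by_contra! hlt
      have hkk := hK k hk
      have hw : B (D k) (D k) < 0 := by nlinarith [mul_nonneg hlam.le hkk]
      have hwM : ∀ l ∈ K, B (D k) l = 0 := fun l hl => h.endo_orthogonal hk hl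
      have h1 := h.endo_le_of_timelike hK hwM hw
      have h2 := h.lorentz.sq_apply_le_of_orthogonal_timelike hw (h.endo_self (D k))
        ((h.lorentz.symm _ _).trans (hwM k hk))
      rw [h.endo_skew] at h2
      nlinarith [mul_le_mul_of_nonneg_right h1 hkk,
        mul_pos_of_neg_of_neg hw (sub_neg.2 hlt)]
    have hKnd : ∀ k : K, (∀ l : K, LinearMap.BilinForm.restrict B K k l = 0) → k = 0 :=
      fun k hk => Subtype.ext (hnd k k.2 (hk k))
    obtain ⟨c, b, hbz, hb, -⟩ := exists_orthogonal_basis_extension (ι := Unit)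
      (B := LinearMap.BilinForm.restrict B K) (fun x y => h.lorentz.symm _ _) hKnd
      (fun _ => ⟨z, h.center_mem⟩) (fun i j hij => absurd rfl hij)
      (fun _ => h.unit_ne_zero)
    obtain ⟨m, f, hfb, hf, -⟩ := exists_orthogonal_basis_extension h.lorentz.symm
      h.nondegenerate (fun i => (b i : H)) hb
      (fun i => apply_self_ne_zero_of_orthogonal_basis hKnd b hb i)
    have hfz : f (Sum.inl (Sum.inl ())) = z := by rw [hfb, hbz]
    have hfK : ∀ k, f (Sum.inl (Sum.inr k)) ∈ K := fun k => by rw [hfb]; exact (b _).2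
    have hfM : ∀ i, ∀ k ∈ K, B (f (Sum.inr i)) k = 0 := fun i k hk => by
      have h1 := congrArg K.subtype (b.sum_repr ⟨k, hk⟩)
      rw [map_sum] at h1
      rw [← (show _ = k from h1), map_sum]
      refine Finset.sum_eq_zero fun j _ => ?_
      rw [map_smul, map_smul, Submodule.subtype_apply, ← hfb, hf _ _ (by simp), smul_zero]
    have hγ : ∀ k, 0 < B (f (Sum.inl (Sum.inr k))) (f (Sum.inl (Sum.inr k))) :=
      fun k => hpos _ (hfK k) (f.ne_zero _)
    have hfz' : ∀ k, B (f (Sum.inl (Sum.inr k))) z = 0 := fun k => by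
      rw [← hfz]; exact hf _ _ (by simp)
    have ha := sum_eq_of_einstein_traces
      (fun k => (hγ k).ne') (fun i => apply_self_ne_zero_of_orthogonal_basis h.nondegenerate f hf _)
      (fun k => h.apply_endo_endo_adapted f hf hfz hfK k)
      (fun k => h.einstein_adapted_derived f hf hfz hfK (hfK k) (hfz' k))
      (fun i => h.einstein_adapted_orthogonal f hf hfz hfK hfM (hfM i))
      (h.einstein_adapted_center f hf hfz hfK)
    have hb := Finset.sum_le_sum fun k (_ : k ∈ Finset.univ) =>
      mul_le_mul_of_nonneg_left (hbound _ (hfK k)) (inv_nonneg.2 (hγ k).le)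
    rw [ha, Finset.sum_congr rfl fun k _ => (by have := (hγ k).ne'; field_simp :
      _ = -2 * lam)] at hb
    simp only [Finset.sum_const, Finset.card_univ, nsmul_eq_mul] at hb
    have h1 : (0 : ℝ) ≤ (Fintype.card (Fin m) : ℝ) := by positivity
    have h2 : (0 : ℝ) ≤ (Fintype.card (Fin c) : ℝ) := by positivity
    nlinarith [mul_nonneg h1 hlam.le, mul_nonneg h2 hlam.le]

lemma exists_lie_ne_smul_center : ∃ x y : H, ∀ r : ℝ, ⁅x, y⁆ ≠ r • z := by
  by_contra! hxy
  obtain ⟨k, hk, hkz, hk0⟩ := h.exists_endo_ne_zero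
  suffices k = 0 from hk0 (by rw [this, map_zero])
  refine h.nondegenerate k fun w => ?_
  have h1 := h.orthogonal_of_lie (w - B w z • z) (fun x y => by
    obtain ⟨r, hr⟩ := hxy x y
    simp [hr, h.unit_eq_one]) k hk
  rw [map_sub, map_smul, LinearMap.sub_apply, LinearMap.smul_apply, h.lorentz.symm z, hkz,
    smul_zero, sub_zero] at h1
  rw [h.lorentz.symm, h1]

/-- If the derived algebra is semidefinite with a null vector, the endomorphism satisfies a length
bound on its orthogonal. -/
lemma endo_le_of_null (hK : ∀ k ∈ K, 0 ≤ B k k) {e : H} (he : e ∈ K) (he0 : e ≠ 0)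
    (hee : B e e = 0) {u : H} (hu : ∀ k ∈ K, B u k = 0) :
    B (D u) (D u) ≤ -2 * lam * B u u := by
  have hez : B e z = 0 := h.lorentz.apply_eq_zero_of_nonneg hK he hee h.center_mem
  obtain ⟨t, htt, het⟩ : ∃ t, B t t < 0 ∧ B e t = B t t := by
    obtain ⟨t₀, ht₀, -⟩ := h.lorentz.exists_timelike
    set t₁ := t₀ - B t₀ z • z with ht₁
    have h1 : B t₁ t₁ < 0 := by
      have : B t₁ t₁ = B t₀ t₀ - B t₀ z ^ 2 := by
        simp [ht₁, h.unit_eq_one, h.lorentz.symm z t₀]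
        ring
      nlinarith [sq_nonneg (B t₀ z)]
    have h2 := h.lorentz.apply_ne_zero_of_null h1 hee he0
    refine ⟨(B e t₁ / B t₁ t₁) • t₁, ?_, ?_⟩
    · simp only [map_smul, LinearMap.smul_apply, smul_eq_mul]
      rw [← mul_assoc]
      exact mul_neg_of_pos_of_neg (mul_self_pos.2 (div_ne_zero h2 h1.ne)) h1
    · simp only [map_smul, LinearMap.smul_apply, smul_eq_mul]
      field_simp [h1.ne]
  set s := e - t with hs
  have hss : B s s = -B t t := by
    simp [hs, hee, h.lorentz.symm t e, het]
  have hst : B s t = 0 := by simp [hs, het]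
  obtain ⟨n, f, hfts, hf, -⟩ := exists_orthogonal_basis_extension (ι := Unit ⊕ Unit)
    h.lorentz.symm h.nondegenerate (Sum.elim (fun _ => t) (fun _ => s))
    (by rintro (i | i) (j | j) hij <;> simp_all)
    (by rintro (i | i) <;> simp [hss, htt.ne])
  have hft : f (Sum.inl (Sum.inl ())) = t := hfts _
  have hfs : f (Sum.inl (Sum.inr ())) = s := hfts _
  have hpos : ∀ i, 0 < B (f (Sum.inr i)) (f (Sum.inr i)) := fun i =>
    h.lorentz.pos_of_orthogonal_timelike htt
      (by rw [← hft]; exact hf _ _ (by simp)) (f.ne_zero _)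
  obtain ⟨r, hr⟩ := h.lie_derived u e he
  have hus : ⁅u, s⁆ = r • z - ⁅u, t⁆ := by rw [hs, lie_sub, hr]
  have key : B ⁅u, s⁆ ⁅u, s⁆ - B z ⁅u, s⁆ ^ 2 = B ⁅u, t⁆ ⁅u, t⁆ - B z ⁅u, t⁆ ^ 2 := by
    rw [hus]
    simp only [map_sub, map_smul, LinearMap.sub_apply, LinearMap.smul_apply, smul_eq_mul,
      h.unit_eq_one, h.lorentz.symm ⁅u, t⁆ z]
    ring
  rw [← h.einstein_orthogonal f hf hu u, apply_eq_sum_orthogonal_basis h.nondegenerate f hf (D u)]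
  simp only [Fintype.sum_sum_type, Finset.univ_unique, Finset.sum_singleton, PUnit.default_eq_unit,
    hft, hfs, hss, h.apply_endo]
  refine add_le_add (le_of_eq ?_) (Finset.sum_le_sum fun i _ =>
    mul_le_mul_of_nonneg_left ?_ (inv_nonneg.2 (hpos i).le))
  · rw [inv_neg]
    linear_combination (B t t)⁻¹ * key
  · rw [← pow_two, h.lorentz.symm z]
    exact h.sq_center_le_of_nonneg hK (h.lie_mem _ _)

lemma eq_zero_of_null (hK : ∀ k ∈ K, 0 ≤ B k k) : ∀ e ∈ K, B e e = 0 → e = 0 := by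
  intro e he hee
  by_contra he0
  have heK : ∀ k ∈ K, B e k = 0 := fun k hk => h.lorentz.apply_eq_zero_of_nonneg hK he hee hk
  have hD := fun u => h.endo_le_of_null hK he he0 hee (u := u)
  obtain ⟨t, htt, -⟩ := h.lorentz.exists_timelike
  have het := h.lorentz.apply_ne_zero_of_null htt hee he0
  obtain ⟨μ, hμ⟩ := (h.lorentz.nonneg_of_orthogonal_null hee he0 (h.endo_self e)).2
    (by simpa [hee] using hD e heK)
  have hμ0 : μ ≠ 0 := fun h0 => he0 (h.eq_zero_of_endo_eq_zero he (heK z h.center_mem)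
    (by rw [hμ, h0, zero_smul]))
  have hlam : lam = μ ^ 2 / 2 := by
    obtain ⟨n, f, -, hf, -⟩ := exists_orthogonal_basis_extension (ι := Empty) h.lorentz.symm
      h.nondegenerate Empty.elim (fun i => i.elim) (fun i => i.elim)
    have h1 := h.einstein_derived f hf he t
    have h2 := h.endo_skew t e
    simp only [heK _ (h.lie_mem _ _), zero_mul, mul_zero, Finset.sum_const_zero, h.unit_eq_one,
      hμ, map_smul, LinearMap.smul_apply, smul_eq_mul, h.lorentz.symm _ (D t),
      h.lorentz.symm t e] at h1 h2
    rw [h2] at h1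
    refine mul_right_cancel₀ het ?_
    linarith
  have hM : ∀ u, (∀ k ∈ K, B u k = 0) → ∃ ν : ℝ, u = ν • e := fun u hu => by
    have h1 : B (D u) e = 0 := by
      rw [h.endo_skew, hμ, map_smul, hu e he, smul_zero, neg_zero]
    have h2 := (h.lorentz.nonneg_of_orthogonal_null hee he0 h1).1
    have h3 : 0 < lam := by rw [hlam]; positivity
    exact (h.lorentz.nonneg_of_orthogonal_null hee he0 (hu e he)).2
      (by nlinarith [h.endo_le_of_null hK he he0 hee hu])
  have heK' : ∀ x, ∃ a : ℝ, x - a • t ∈ K := fun x => by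
    refine ⟨B e x / B e t, mem_of_forall_orthogonal h.lorentz.symm h.nondegenerate
      fun u hu => ?_⟩
    obtain ⟨ν, rfl⟩ := hM u hu
    simp only [map_sub, map_smul, LinearMap.smul_apply, smul_eq_mul]
    field_simp
    ring
  obtain ⟨x, y, hxy⟩ := h.exists_lie_ne_smul_center
  obtain ⟨a, ha⟩ := heK' x
  obtain ⟨b, hb⟩ := heK' y
  obtain ⟨r, hr⟩ := h.lie_derived x _ hb
  obtain ⟨s, hs⟩ := h.lie_derived t _ ha
  refine hxy (r - b * s) ?_
  have h1 : ⁅x, y⁆ = ⁅x, y - b • t⁆ - b • ⁅t, x - a • t⁆ := by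
    rw [lie_sub, lie_sub, lie_smul, lie_smul, lie_self, ← lie_skew t x]
    module
  rw [h1, hr, hs, smul_smul, ← sub_smul]

lemma exists_timelike_derived : ∃ k ∈ K, B k k < 0 := by
  by_contra! hK
  obtain ⟨k, hk, hk0⟩ := h.exists_timelike_derived_of_nondegenerate (h.eq_zero_of_null hK)
  exact absurd (hK k hk) (not_le.2 hk0)

end IsEinsteinNilpotent

/-- The spectral theorem for a positive definite bilinear form. -/
lemma exists_orthonormal_eigenbasis {V : Type*} [AddCommGroup V] [Module ℝ V] [Module.Finite ℝ V]
    {B : V →ₗ[ℝ] V →ₗ[ℝ] ℝ} (hsymm : ∀ u v, B u v = B v u) (hpos : ∀ u, u ≠ 0 → 0 < B u u)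
    (T : Module.End ℝ V) (hT : ∀ u v, B (T u) v = B u (T v)) :
    ∃ (b : Basis (Fin (finrank ℝ V)) ℝ V) (x : Fin (finrank ℝ V) → ℝ),
      (∀ i j, B (b i) (b j) = if i = j then 1 else 0) ∧ ∀ i, T (b i) = x i • b i := by
  let core : InnerProductSpace.Core ℝ V :=
    { inner := fun u v => B u v
      conj_inner_symm := fun u v => hsymm v u
      re_inner_nonneg := fun u => by
        by_cases hu : u = 0
        · simp [hu]
        · exact (hpos u hu).le
      add_left := fun u v w => by simp
      smul_left := fun u v r => by simp
      definite := fun u hu => by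
        by_contra h
        exact (hpos u h).ne' hu }
  let : NormedAddCommGroup V := core.toNormedAddCommGroup
  let : InnerProductSpace ℝ V := InnerProductSpace.ofCore core.toCore
  have hTs : LinearMap.IsSymmetric T := hT
  refine ⟨(hTs.eigenvectorBasis rfl).toBasis, hTs.eigenvalues rfl, fun i j => ?_, fun i => ?_⟩
  · rw [OrthonormalBasis.coe_toBasis]
    exact orthonormal_iff_ite.1 (hTs.eigenvectorBasis rfl).orthonormal i j
  · rw [OrthonormalBasis.coe_toBasis]
    exact hTs.apply_eigenvectorBasis rfl i

lemma sum_subtype_ne_zero {ι : Type*} [Fintype ι] {x g : ι → ℝ} [Fintype {i // x i ≠ 0}]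
    (hg : ∀ i, x i = 0 → g i = 0) : ∑ i : {i // x i ≠ 0}, g i = ∑ i, g i := by
  classical
  rw [← Finset.sum_subtype (Finset.univ.filter fun i => x i ≠ 0) (by simp) g]
  exact Finset.sum_filter_of_ne fun i _ hi h0 => hi (hg i h0)

namespace IsEinsteinNilpotent

variable {H : Type*} [LieRing H] [LieAlgebra ℝ H] [Module.Finite ℝ H] {B : H →ₗ[ℝ] H →ₗ[ℝ] ℝ}
  {z : H} {D : Module.End ℝ H} {K : Submodule ℝ H} {lam : ℝ}
  (h : IsEinsteinNilpotent B z D K lam)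
include h

/-- A frame of the orthogonal of the derived algebra diagonalizing the square of `D`. -/
lemma exists_adapted_frame :
    ∃ (m : ℕ) (v c : Fin m → H) (x : Fin m → ℝ),
      (∀ i, ∀ k ∈ K, B (v i) k = 0) ∧ (∀ i j, B (v i) (v j) = if i = j then 1 else 0) ∧
      (∀ i, c i ∈ K) ∧ (∀ i, ∀ k ∈ K, B (c i) k = B (D k) (v i)) ∧
      (∀ i, D (c i) = x i • v i) ∧ ∀ u, (∀ i, B u (v i) = 0) → u ∈ K := by
  obtain ⟨t, htK, ht⟩ := h.exists_timelike_derived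
  obtain ⟨P, hPK, hP⟩ := exists_orthogonal_projection (K := K) h.lorentz.symm
    fun k hk hkl => by
      by_contra hk0
      exact (h.lorentz.pos_of_orthogonal_timelike ht (hkl t htK) hk0).ne' (hkl k hk)
  let M : Submodule ℝ H := LinearMap.BilinForm.orthogonal B K
  have hM : ∀ m ∈ M, ∀ k ∈ K, B m k = 0 := fun m hm k hk => by
    rw [h.lorentz.symm]; exact hm k hk
  let A : Module.End ℝ H := -(D ∘ₗ P ∘ₗ D)
  have hA : ∀ u, A u = D (-P (D u)) := fun u => by simp [A]
  have hAM : ∀ u ∈ M, A u ∈ M := fun u _ k hk => by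
    rw [h.lorentz.symm, hA]
    exact h.endo_orthogonal (K.neg_mem (hPK _)) hk
  have hAP : ∀ u w, B (A u) w = B (P (D u)) (P (D w)) := fun u w => by
    rw [hA, h.endo_skew, map_neg, LinearMap.neg_apply, neg_neg, h.lorentz.symm _ (D w),
      ← hP _ _ (hPK _), h.lorentz.symm]
  obtain ⟨b, x, hb, hx⟩ := exists_orthonormal_eigenbasis
    (B := LinearMap.BilinForm.restrict B M) (fun u w => h.lorentz.symm _ _)
    (fun u hu => h.lorentz.pos_of_orthogonal_timelike ht (hM u u.2 t htK)
      fun h0 => hu (Subtype.ext h0))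
    (A.restrict hAM) (fun u w => (hAP u w).trans ((h.lorentz.symm _ _).trans
      ((hAP w u).symm.trans (h.lorentz.symm _ _))))
  refine ⟨_, fun i => b i, fun i => -P (D (b i)), x, fun i => hM _ (b i).2, hb,
    fun i => K.neg_mem (hPK _), fun i k hk => ?_, fun i => ?_, fun u hu => ?_⟩
  · rw [map_neg, LinearMap.neg_apply, hP _ k hk, h.endo_skew, neg_neg, h.lorentz.symm]
  · rw [← hA]
    exact congrArg M.subtype (hx i)
  · refine mem_of_forall_orthogonal h.lorentz.symm h.nondegenerate fun w hw => ?_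
    have hwM : w ∈ M := fun k hk => (h.lorentz.symm _ _).trans (hw k hk)
    have h1 := congrArg M.subtype (b.sum_repr ⟨w, hwM⟩)
    rw [map_sum] at h1
    rw [h.lorentz.symm, ← (show _ = w from h1), map_sum]
    refine Finset.sum_eq_zero fun j _ => ?_
    rw [map_smul, map_smul, Submodule.subtype_apply, hu, smul_zero]

theorem ricci_flat_and_finrank : lam = 0 ∧ (finrank ℝ H = 6 ∨ finrank ℝ H = 7) := by
  classical
  obtain ⟨m, v, c, x, hvM, hvv, hcK, hcD, hDc, hK⟩ := h.exists_adapted_frame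
  have hcz : ∀ i, B (c i) z = 0 := fun i => by
    rw [hcD i z h.center_mem, h.endo_center, map_zero, LinearMap.zero_apply]
  have hcc : ∀ i j, B (c i) (c j) = if i = j then x i else 0 := fun i j => by
    rw [hcD i _ (hcK j), hDc, map_smul, LinearMap.smul_apply, hvv]
    by_cases hij : i = j
    · simp [hij]
    · simp [hij, Ne.symm hij]
  have hc0 : ∀ i, x i = 0 → c i = 0 := fun i hi =>
    h.eq_zero_of_endo_eq_zero (hcK i) (hcz i) (by rw [hDc, hi, zero_smul])
  let F : (Unit ⊕ {i // x i ≠ 0}) ⊕ Fin m → H :=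
    Sum.elim (Sum.elim (fun _ => z) fun k => c k) v
  have hF : ∀ i j, i ≠ j → B (F i) (F j) = 0 := by
    rintro ((i | i) | i) ((j | j) | j) hij
    · exact absurd rfl hij
    · exact (h.lorentz.symm _ _).trans (hcz j)
    · exact (h.lorentz.symm _ _).trans (hvM j z h.center_mem)
    · exact hcz i
    · exact (hcc i j).trans (if_neg fun h' => hij (by rw [Subtype.ext h']))
    · exact (h.lorentz.symm _ _).trans (hvM j _ (hcK i))
    · exact hvM i z h.center_mem
    · exact hvM i _ (hcK j)
    · exact (hvv i j).trans (if_neg fun h' => hij (by rw [h']))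
  obtain ⟨n, g, hgF, hg, -⟩ := exists_orthogonal_basis_extension h.lorentz.symm h.nondegenerate
    F hF (by
      rintro ((i | i) | i)
      · exact h.unit_ne_zero
      · simp [F, hcc, i.2]
      · simp [F, hvv])
  have hgr : ∀ r i, B (g (Sum.inr r)) (F i) = 0 := fun r i => by
    rw [← hgF]; exact hg _ _ (by simp)
  have : IsEmpty (Fin n) := ⟨fun r => g.ne_zero (Sum.inr r) (by
    have h1 : g (Sum.inr r) ∈ K := hK _ fun i => hgr r (Sum.inr i)
    refine h.eq_zero_of_endo_eq_zero h1 (hgr r (Sum.inl (Sum.inl ()))) ?_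
    have h2 : D (g (Sum.inr r)) ∈ K := hK _ fun i => by
      rw [← hcD i _ h1]
      by_cases hi : x i = 0
      · rw [hc0 i hi, map_zero, LinearMap.zero_apply]
      · exact (h.lorentz.symm _ _).trans (hgr r (Sum.inl (Sum.inr ⟨i, hi⟩)))
    refine h.nondegenerate _ fun w => ?_
    rw [apply_eq_sum_orthogonal_basis h.nondegenerate g hg]
    refine Finset.sum_eq_zero fun s _ => ?_
    have h3 : B (D (g (Sum.inr r))) (g s) = 0 := by
      rcases s with s | s
      · rw [hgF]
        rcases s with s | s
        · refine h.endo_orthogonal h1 ?_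
          rcases s with s | s
          exacts [h.center_mem, hcK s]
        · exact (h.lorentz.symm _ _).trans (hvM s _ h2)
      · exact h.endo_orthogonal h1 (hK _ fun i => hgr s (Sum.inr i))
    rw [h3]
    ring)⟩
  let f : Basis ((Unit ⊕ {i // x i ≠ 0}) ⊕ Fin m) ℝ H := g.reindex (Equiv.sumEmpty _ _)
  have hfF : ∀ i, f i = F i := fun i => by simp [f, hgF]
  have hf : ∀ i j, i ≠ j → B (f i) (f j) = 0 := fun i j hij => by
    rw [hfF, hfF]; exact hF i j hij
  have hfz : f (Sum.inl (Sum.inl ())) = z := hfF _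
  have hfc : ∀ k, f (Sum.inl (Sum.inr k)) = c k := fun k => hfF _
  have hfv : ∀ i, f (Sum.inr i) = v i := fun i => hfF _
  have hfK : ∀ k, f (Sum.inl (Sum.inr k)) ∈ K := fun k => by rw [hfc]; exact hcK k
  have hfM : ∀ i, ∀ k ∈ K, B (f (Sum.inr i)) k = 0 := fun i k hk => by rw [hfv]; exact hvM i k hk
  have hcard : finrank ℝ H = 1 + (Finset.univ.filter fun i => x i ≠ 0).card + m := by
    rw [finrank_eq_card_basis f]
    simp [Fintype.card_subtype]
  have hsum : ∀ u w, B u w = B u z * B w z +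
      ∑ k, (x k)⁻¹ * (B u (c k) * B w (c k)) + ∑ i, B u (v i) * B w (v i) := fun u w => by
    rw [apply_eq_sum_orthogonal_basis h.nondegenerate f hf,
      ← sum_subtype_ne_zero (x := x) (fun i hi => by simp [hi])]
    simp [hfz, hfc, hfv, hcc, hvv, h.unit_eq_one]
  obtain ⟨o, ho⟩ : ∃ o, x o < 0 := by
    by_contra! hx
    obtain ⟨t, ht, -⟩ := h.lorentz.exists_timelike
    rw [hsum] at ht
    refine absurd ht (not_lt.2 (add_nonneg (add_nonneg (mul_self_nonneg _) ?_) ?_))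
    · exact Finset.sum_nonneg fun k _ => mul_nonneg (inv_nonneg.2 (hx k)) (mul_self_nonneg _)
    · exact Finset.sum_nonneg fun k _ => mul_self_nonneg _
  have hres := lorentzian_structure_constants (x := x) (o := o) (lam := lam)
    (φ := fun k i j => B (c k) ⁅v i, v j⁆) (q := fun k => ∑ j, B z ⁅v k, v j⁆ ^ 2)
    (fun k i j => by rw [← lie_skew, map_neg])
    (fun k i j => by
      simp only [hcD _ _ (h.lie_mem _ _), h.apply_endo]
      have hj := lie_jacobi (v k) (v i) (v j)
      rw [← lie_skew (v k), ← lie_skew (v i) ⁅v j, v k⁆, ← lie_skew (v j) ⁅v k, v i⁆, ← neg_add,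
        ← neg_add, neg_eq_zero] at hj
      rw [← map_add, ← map_add, ← map_zero (B z), ← hj])
    (fun k i j hk => by rw [hc0 k hk, map_zero, LinearMap.zero_apply])
    (fun k => Finset.sum_nonneg fun j _ => sq_nonneg _)
    (fun k hk => Finset.sum_eq_zero fun j _ => by
      have h1 := h.endo_derived_orthogonal (hcK k) (hvM j)
      rw [hDc, map_smul, LinearMap.smul_apply, smul_eq_mul] at h1
      rw [← h.apply_endo, h.endo_skew, (mul_eq_zero.1 h1).resolve_left hk]
      simp)
    (fun k => by
      by_cases hk : x k = 0
      · simp [hc0 k hk, hk]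
      · have h1 := h.einstein_adapted_derived f hf hfz hfK (hcK k) (hcz k)
        simp only [hfv, hvv, hDc, map_smul, LinearMap.smul_apply, hcc, if_true, inv_one, one_mul,
          smul_eq_mul, mul_one] at h1
        linarith)
    (fun k => by
      have h1 := h.einstein_adapted_orthogonal f hf hfz hfK hfM (hvM k)
      simp only [hfv, hfc, hvv, hDc, map_smul, LinearMap.smul_apply, hcc, if_true, inv_one, one_mul,
          smul_eq_mul, mul_one] at h1
      have h2 : ∀ y, ∑ l : {l // x l ≠ 0}, (x l)⁻¹ * B (c l) y ^ 2 =
          ∑ l, (x l)⁻¹ * B (c l) y ^ 2 := fun y =>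
        sum_subtype_ne_zero (x := x) (g := fun l => (x l)⁻¹ * B (c l) y ^ 2) fun l hl => by
          simp [hl]
      rw [sum_subtype_ne_zero (x := x)
          (g := fun l => (x l)⁻¹ * (x l * if l = k then 1 else 0) ^ 2) fun l hl => by simp [hl],
        Finset.sum_eq_single k (fun l _ hl => by simp [hl]) (by simp), Finset.sum_add_distrib] at h1
      simp only [h2, if_true, mul_one] at h1
      have h3 : (x k)⁻¹ * x k ^ 2 = x k := by
        by_cases hk : x k = 0
        · simp [hk]
        · field_simp
      linarith)
    (by
      have h1 := h.einstein_adapted_center f hf hfz hfK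
      simp only [hfv, hfc, hvv, hDc, map_smul, LinearMap.smul_apply, hcc, if_true, inv_one, one_mul,
          smul_eq_mul, mul_one] at h1
      rw [sum_subtype_ne_zero (x := x) (g := fun l => (x l)⁻¹ * (x l * x l))
        fun l hl => by simp [hl]] at h1
      rw [← h1]
      congr 2
      refine Finset.sum_congr rfl fun k _ => ?_
      by_cases hk : x k = 0
      · simp [hk]
      · field_simp)
    ho
    (fun k hk => by
      have h1 := h.lorentz.nonneg_of_orthogonal_timelike (t := c o) (v := c k)
        (by rw [hcc, if_pos rfl]; exact ho) (by rw [hcc, if_neg hk])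
      rwa [hcc, if_pos rfl] at h1)
    (fun a ha ha0 => by
      have hwv : ∀ i, B (∑ k, a k • v k) (v i) = a i := fun i => by
        simp [map_sum, LinearMap.sum_apply, hvv]
      have hwl : ∀ j y, B y ⁅∑ k, a k • v k, v j⁆ = ∑ i, a i * B y ⁅v i, v j⁆ := fun j y => by
        simp [sum_lie, map_sum]
      have hw : LieAlgebra.ad ℝ H (∑ k, a k • v k) = (0 : Module.End ℝ H) := by
        refine f.ext fun s => ?_
        rw [LieAlgebra.ad_apply, LinearMap.zero_apply]
        rcases s with (s | s) | s
        · rw [hfz, h.lie_center]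
        · rw [hfc, ← lie_skew, h.lie_derived_eq' (hcK s), hDc, map_smul, LinearMap.smul_apply,
            h.lorentz.symm, hwv, smul_eq_mul]
          by_cases hs : a s = 0
          · simp [hs]
          · simp [(ha0 s hs).1]
        · rw [hfv]
          refine h.nondegenerate _ fun y => ?_
          have h1 : ∀ k, B ⁅∑ k, a k • v k, v s⁆ (c k) = 0 := fun k => by
            rw [h.lorentz.symm, hwl, ha]
          have h2 : B ⁅∑ k, a k • v k, v s⁆ z = 0 := by
            rw [h.lorentz.symm, hwl]
            refine Finset.sum_eq_zero fun i _ => ?_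
            by_cases hi : a i = 0
            · rw [hi, zero_mul]
            · have h3 := (Finset.sum_eq_zero_iff_of_nonneg fun j _ => sq_nonneg _).1 (ha0 i hi).2 s
                (Finset.mem_univ _)
              rw [pow_eq_zero_iff two_ne_zero] at h3
              rw [h3, mul_zero]
          rw [hsum, h2]
          simp [h1, h.lorentz.symm _ (v _), hvM _ _ (h.lie_mem _ _)]
      obtain ⟨r, hr⟩ := h.mem_center (∑ k, a k • v k) fun y => by
        rw [← lie_skew, ← LieAlgebra.ad_apply ℝ, hw, LinearMap.zero_apply, neg_zero]
      ext i
      rw [Pi.zero_apply, ← hwv i, hr, map_smul, LinearMap.smul_apply, h.lorentz.symm,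
        hvM i z h.center_mem, smul_zero])
  obtain ⟨h1, h2, h3⟩ := hres
  rw [Fintype.card_fin] at h2
  refine ⟨h1, ?_⟩
  rw [hcard]
  omega

end IsEinsteinNilpotent

/-- A unit generator of the center exhibits the metric as one covered by
`IsEinsteinNilpotent`. -/
lemma exists_isEinsteinNilpotent {H : Type*} [LieRing H] [LieAlgebra ℝ H]
    {B : H →ₗ[ℝ] H →ₗ[ℝ] ℝ} (hB : IsLorentzForm B)
    (hnd : ∀ u : H, (∀ v : H, B u v = 0) → u = 0)
    (h3 : LieModule.lowerCentralSeries ℝ H H 3 = ⊥)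
    (h2 : LieModule.lowerCentralSeries ℝ H H 2 ≠ ⊥)
    (hZdim : finrank ℝ (LieAlgebra.center ℝ H).toSubmodule = 1)
    (hZnd : ∀ z ∈ LieAlgebra.center ℝ H,
      (∀ w ∈ LieAlgebra.center ℝ H, B z w = 0) → z = 0)
    {adStar : H → Module.End ℝ H} (hadStar : ∀ u v w : H, B (adStar u v) w = B v ⁅u, w⁆)
    {Jm : H → Module.End ℝ H} (hJm : ∀ u v w : H, B (Jm u v) w = B u ⁅v, w⁆) {lam : ℝ}
    (hEinstein : ∀ u v : H,
      -(1/2) * LinearMap.trace ℝ H ((LieAlgebra.ad ℝ H u : Module.End ℝ H) ∘ₗ adStar v)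
        - (1/4) * LinearMap.trace ℝ H (Jm u ∘ₗ Jm v) = lam * B u v) :
    ∃ z : H, IsEinsteinNilpotent B z (Jm z)
      (LieModule.lowerCentralSeries ℝ H H 1).toSubmodule lam := by
  have hlie : ∀ (k : ℕ) (x y : H), y ∈ LieModule.lowerCentralSeries ℝ H H k →
      ⁅x, y⁆ ∈ LieModule.lowerCentralSeries ℝ H H (k + 1) := fun k x y hy => by
    rw [LieModule.lowerCentralSeries_succ]
    exact LieSubmodule.lie_mem_lie (LieSubmodule.mem_top x) hy
  have hcenter : ∀ y : H, y ∈ LieAlgebra.center ℝ H ↔ ∀ x : H, ⁅x, y⁆ = 0 := fun y => by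
    rw [LieModule.mem_maxTrivSubmodule]
  have h2c : ∀ y ∈ LieModule.lowerCentralSeries ℝ H H 2, y ∈ LieAlgebra.center ℝ H :=
    fun y hy => (hcenter y).2 fun x => by
      have := hlie 2 x y hy
      rwa [h3, LieSubmodule.mem_bot] at this
  obtain ⟨⟨w, hw⟩, hw0, hwgen⟩ := finrank_eq_one_iff'.1 hZdim
  have hw0' : w ≠ 0 := fun h0 => hw0 (Subtype.ext h0)
  have hgen : ∀ y ∈ LieAlgebra.center ℝ H, ∃ r : ℝ, y = r • w := fun y hy => by
    obtain ⟨r, hr⟩ := hwgen ⟨y, hy⟩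
    exact ⟨r, (congrArg Subtype.val hr).symm⟩
  have hww : B w w ≠ 0 := fun h0 => hw0' (hZnd w hw fun y hy => by
    obtain ⟨r, rfl⟩ := hgen y hy
    rw [map_smul, h0, smul_zero])
  have hs : 0 < Real.sqrt |B w w| := Real.sqrt_pos.2 (abs_pos.2 hww)
  have hsq : Real.sqrt |B w w| * Real.sqrt |B w w| = |B w w| := Real.mul_self_sqrt (abs_nonneg _)
  set s := Real.sqrt |B w w|
  have hgen' : ∀ y ∈ LieAlgebra.center ℝ H, ∃ r : ℝ, y = r • s⁻¹ • w := fun y hy => by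
    obtain ⟨r, rfl⟩ := hgen y hy
    exact ⟨r * s, by rw [smul_smul, mul_assoc, mul_inv_cancel₀ hs.ne', mul_one]⟩
  have hwlie : ∀ x : H, ⁅x, w⁆ = 0 := (hcenter w).1 hw
  have h12 : LieModule.lowerCentralSeries ℝ H H 2 ≤ LieModule.lowerCentralSeries ℝ H H 1 :=
    LieModule.antitone_lowerCentralSeries ℝ H H one_le_two
  obtain ⟨c, hc, hc0⟩ : ∃ c ∈ LieModule.lowerCentralSeries ℝ H H 2, c ≠ 0 := by
    by_contra! h0
    exact h2 ((LieSubmodule.eq_bot_iff _).2 h0)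
  have hspan : (LieModule.lowerCentralSeries ℝ H H 1).toSubmodule =
      Submodule.span ℝ {y | ∃ a b : H, ⁅a, b⁆ = y} := by
    rw [LieModule.lowerCentralSeries_succ, LieSubmodule.lieIdeal_oper_eq_linear_span']
    simp
  have hKlie : ∀ x y : H, ⁅x, y⁆ ∈ LieModule.lowerCentralSeries ℝ H H 1 := fun x y =>
    hlie 0 x y (by simp)
  refine ⟨s⁻¹ • w, ⟨hB, hnd, ?_, fun u v => hJm _ _ _, fun x => ?_, ?_, hKlie, ?_, ?_, ?_, ?_, ?_,
    ?_⟩⟩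
  · rw [map_smul, map_smul, LinearMap.smul_apply, smul_eq_mul, smul_eq_mul]
    rcases lt_or_gt_of_ne hww with hlt | hlt
    · right
      rw [abs_of_neg hlt] at hsq
      field_simp
      linarith
    · left
      rw [abs_of_pos hlt] at hsq
      field_simp
      linarith
  · rw [lie_smul, hwlie, smul_zero]
  · obtain ⟨r, rfl⟩ := hgen c (h2c c hc)
    have hr : r ≠ 0 := fun h0 => hc0 (by rw [h0, zero_smul])
    have := Submodule.smul_mem (LieModule.lowerCentralSeries ℝ H H 1).toSubmodule (s⁻¹ * r⁻¹)
      (h12 hc)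
    rwa [smul_smul, mul_assoc, inv_mul_cancel₀ hr, mul_one] at this
  · intro m hm k hk
    rw [hspan] at hk
    induction hk using Submodule.span_induction with
    | mem y hy => obtain ⟨a, b, rfl⟩ := hy; exact hm a b
    | zero => exact map_zero _
    | add y y' _ _ hy hy' => rw [map_add, hy, hy', add_zero]
    | smul r y _ hy => rw [map_smul, hy, smul_zero]
  · exact fun x k hk => hgen' _ (h2c _ (hlie 1 x k hk))
  · intro k hk l hl
    rw [hspan] at hl
    induction hl using Submodule.span_induction with
    | mem y hy =>
      obtain ⟨a, b, rfl⟩ := hy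
      have h1 : ∀ a b : H, ⁅⁅k, a⁆, b⁆ = 0 := fun a b => by
        rw [← lie_skew k a, neg_lie, lie_skew]
        exact (hcenter _).1 (h2c _ (hlie 1 a k hk)) b
      rw [leibniz_lie, h1, ← lie_skew, h1, neg_zero, add_zero]
    | zero => exact lie_zero _
    | add y y' _ _ hy hy' => rw [lie_add, hy, hy', add_zero]
    | smul r y _ hy => rw [lie_smul, hy, smul_zero]
  · exact fun y hy => hgen' y ((hcenter y).2 hy)
  · by_contra! h0
    refine h2 ?_
    rw [LieModule.lowerCentralSeries_succ, LieSubmodule.lie_eq_bot_iff]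
    exact fun x _ k hk => h0 k hk x
  · intro ι _ f hf u v
    rw [← hEinstein, trace_ad_comp_adjoint hnd hadStar f hf, trace_comp_skew hnd hJm f hf]
    ring

/-- Let `h` be a 3-step nilpotent real Lie algebra with `dim Z(h) = 1` and
`⟨·,·⟩` an Einstein Lorentzian inner product on `h` such that `Z(h)` is nondegenerate.  Then
`⟨·,·⟩` is Ricci-flat and `dim h ∈ {6,7}`. -/
theorem statement15
    {H : Type*} [LieRing H] [LieAlgebra ℝ H] [Module.Finite ℝ H]
    (B : H →ₗ[ℝ] H →ₗ[ℝ] ℝ)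
    (hsymm : ∀ u v : H, B u v = B v u)
    (hnd : ∀ u : H, (∀ v : H, B u v = 0) → u = 0)
    (hLor : IsLorentzianForm B)
    -- `h` is 3-step nilpotent: `C⁴(h) = 0` and `C³(h) ≠ 0`
    (h3step : LieModule.lowerCentralSeries ℝ H H 3 = ⊥ ∧
      LieModule.lowerCentralSeries ℝ H H 2 ≠ ⊥)
    -- `dim Z(h) = 1`
    (hZdim : Module.finrank ℝ (LieAlgebra.center ℝ H).toSubmodule = 1)
    -- `Z(h)` is nondegenerate
    (hZnd : ∀ z ∈ LieAlgebra.center ℝ H,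
      (∀ w ∈ LieAlgebra.center ℝ H, B z w = 0) → z = 0)
    -- `adStar u` is the adjoint of `ad u` with respect to `B`
    (adStar : H → Module.End ℝ H)
    (hadStar : ∀ u v w : H, B (adStar u v) w = B v ⁅u, w⁆)
    -- `Jm u` is the skew-symmetric endomorphism `J_u(v) = ad_v*(u)`
    (Jm : H → Module.End ℝ H)
    (hJm : ∀ u v w : H, B (Jm u v) w = B u ⁅v, w⁆)
    -- `⟨·,·⟩` is Einstein
    (lam : ℝ)
    (hEinstein : ∀ u v : H,
      -(1/2) * LinearMap.trace ℝ H ((LieAlgebra.ad ℝ H u : Module.End ℝ H) ∘ₗ adStar v)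
        - (1/4) * LinearMap.trace ℝ H (Jm u ∘ₗ Jm v) = lam * B u v) :
    -- conclusion: Ricci-flat and `dim h ∈ {6, 7}`
    (∀ u v : H,
      -(1/2) * LinearMap.trace ℝ H ((LieAlgebra.ad ℝ H u : Module.End ℝ H) ∘ₗ adStar v)
        - (1/4) * LinearMap.trace ℝ H (Jm u ∘ₗ Jm v) = 0) ∧
    (Module.finrank ℝ H = 6 ∨ Module.finrank ℝ H = 7) := by
  obtain ⟨z, h⟩ := exists_isEinsteinNilpotent (hLor.isLorentzForm hsymm hnd) hnd h3step.1 h3step.2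
    hZdim hZnd hadStar hJm hEinstein
  obtain ⟨rfl, hdim⟩ := h.ricci_flat_and_finrank
  exact ⟨fun u v => by rw [hEinstein, zero_mul], hdim⟩
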